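/- arXiv:2209.04615 — 2 statements merged into one kernel-verified Lean document; each statement's English description precedes it below -/
import Mathlib

section
/- With the q-quadratic lattice, the operators D_x, S_x, and the notion of regular functional as in the context, let (P_n) be the monic OPS with respect to a regular functional u, and suppose that for some integer k ≥ 1 the monic polynomials P_n^{[k]} := (γ_n!/γ_{n+k}!)·D_x^k P_{n+k} also form an OPS (i.e. there is a regular functional v with v(P_n^{[k]}·P_m^{[k]}) = 0 for n ≠ m and v((P_n^{[k]})²) ≠ 0). Then u is x-classical: there exist a nonzero polynomial φ of degree ≤ 2 and a nonzero polynomial ψ of degree ≤ 1 such that u(φ·D_xf) + u(ψ·S_xf) = 0 for every polynomial f. -/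
open Polynomial

noncomputable def qp (q : ℝ) (t : ℂ) : ℂ := Complex.exp (t * (Real.log q : ℂ))

noncomputable def alphaL (q : ℝ) : ℂ := (qp q (1/2) + qp q (-(1/2))) / 2

noncomputable def alphaN (q : ℝ) (n : ℕ) : ℂ :=
  (qp q ((n : ℂ) / 2) + qp q (-((n : ℂ) / 2))) / 2

noncomputable def gammaN (q : ℝ) (n : ℕ) : ℂ :=
  (qp q ((n : ℂ) / 2) - qp q (-((n : ℂ) / 2))) / (qp q (1/2) - qp q (-(1/2)))

noncomputable def latX (q : ℝ) (c1 c2 c3 s : ℂ) : ℂ := c1 * qp q (-s) + c2 * qp q s + c3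

noncomputable def gammaFact (q : ℝ) : ℕ → ℂ
  | 0 => 1
  | n + 1 => gammaFact q n * gammaN q (n + 1)

def IsRegularFunc (u : Polynomial ℂ →ₗ[ℂ] ℂ) : Prop :=
  ∃ P : ℕ → Polynomial ℂ, (∀ n, (P n).Monic) ∧ (∀ n, (P n).natDegree = n) ∧
    (∀ n m, n ≠ m → u (P n * P m) = 0) ∧ (∀ n, u (P n * P n) ≠ 0)

namespace QLattice

/-- The square of half the step of the lattice, as a polynomial in the lattice variable. -/
noncomputable def stepSq (a c₃ c : ℂ) : ℂ[X] := C (a ^ 2 - 1) * ((X - C c₃) ^ 2 - C c)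

/-- Polynomials in the lattice variable with the half-step `ω` adjoined. -/
abbrev StepAlgebra (a c₃ c : ℂ) := QuadraticAlgebra ℂ[X] (stepSq a c₃ c) 0

/-- The shift `f(x(s)) ↦ f(x(s + 1/2))`. -/
noncomputable def shift (a c₃ c : ℂ) : ℂ[X] →ₐ[ℂ] StepAlgebra a c₃ c :=
  aeval ⟨C a * (X - C c₃) + C c₃, 1⟩

/-- The averaging operator. -/
noncomputable def avg (a c₃ c : ℂ) : ℂ[X] →ₗ[ℂ] ℂ[X] where
  toFun f := (shift a c₃ c f).re
  map_add' f g := by simp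
  map_smul' r f := by simp

/-- The divided difference operator. -/
noncomputable def ddiff (a c₃ c : ℂ) : ℂ[X] →ₗ[ℂ] ℂ[X] where
  toFun f := (shift a c₃ c f).im
  map_add' f g := by simp
  map_smul' r f := by simp

/-- The sequences `(α_n, γ_n)`, by recurrence. -/
noncomputable def coeffSeq (a : ℂ) : ℕ → ℂ × ℂ
  | 0 => (1, 0)
  | n + 1 => (a * (coeffSeq a n).1 + (a ^ 2 - 1) * (coeffSeq a n).2,
      (coeffSeq a n).1 + a * (coeffSeq a n).2)

variable (a c₃ c : ℂ)

theorem coeffSeq_succ (n : ℕ) : coeffSeq a (n + 1) =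
    (a * (coeffSeq a n).1 + (a ^ 2 - 1) * (coeffSeq a n).2,
      (coeffSeq a n).1 + a * (coeffSeq a n).2) := rfl

theorem coeffSeq_sq (n : ℕ) :
    (coeffSeq a n).1 ^ 2 - (a ^ 2 - 1) * (coeffSeq a n).2 ^ 2 = 1 := by
  induction n with
  | zero => simp [coeffSeq]
  | succ n ih => simp only [coeffSeq]; linear_combination ih

@[simp] theorem re_shift (f : ℂ[X]) : (shift a c₃ c f).re = avg a c₃ c f := rfl

@[simp] theorem im_shift (f : ℂ[X]) : (shift a c₃ c f).im = ddiff a c₃ c f := rfl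

theorem avg_mul (f g : ℂ[X]) : avg a c₃ c (f * g) =
    avg a c₃ c f * avg a c₃ c g + stepSq a c₃ c * (ddiff a c₃ c f * ddiff a c₃ c g) := by
  rw [← re_shift, map_mul]; simp; ring

theorem ddiff_mul (f g : ℂ[X]) : ddiff a c₃ c (f * g) =
    avg a c₃ c f * ddiff a c₃ c g + ddiff a c₃ c f * avg a c₃ c g := by
  rw [← im_shift, map_mul]; simp

theorem shift_X : shift a c₃ c X = ⟨C a * (X - C c₃) + C c₃, 1⟩ := by
  simp [shift]

@[simp] theorem avg_X : avg a c₃ c X = C a * (X - C c₃) + C c₃ := by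
  rw [← re_shift, shift_X]

@[simp] theorem ddiff_X : ddiff a c₃ c X = 1 := by
  rw [← im_shift, shift_X]

@[simp] theorem avg_C (r : ℂ) : avg a c₃ c (C r) = C r := by
  rw [← re_shift, shift, aeval_C]; rfl

@[simp] theorem ddiff_C (r : ℂ) : ddiff a c₃ c (C r) = 0 := by
  rw [← im_shift, shift, aeval_C]; rfl

theorem avg_C_mul (r : ℂ) (f : ℂ[X]) : avg a c₃ c (C r * f) = C r * avg a c₃ c f := by
  simp [avg_mul]

theorem ddiff_C_mul (r : ℂ) (f : ℂ[X]) : ddiff a c₃ c (C r * f) = C r * ddiff a c₃ c f := by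
  simp [ddiff_mul]

theorem avg_centered_mul (f : ℂ[X]) : avg a c₃ c ((X - C c₃) * f) =
    C a * (X - C c₃) * avg a c₃ c f + stepSq a c₃ c * ddiff a c₃ c f := by
  simp [avg_mul]

theorem ddiff_centered_mul (f : ℂ[X]) : ddiff a c₃ c ((X - C c₃) * f) =
    avg a c₃ c f + C a * (X - C c₃) * ddiff a c₃ c f := by
  simp [ddiff_mul, add_comm]

theorem avg_stepSq : avg a c₃ c (stepSq a c₃ c) =
    C (a ^ 2) * stepSq a c₃ c + C ((a ^ 2 - 1) ^ 2) * (X - C c₃) ^ 2 := by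
  rw [stepSq, avg_C_mul, map_sub (avg a c₃ c), pow_two (X - C c₃), avg_centered_mul]
  simp [stepSq]; ring

theorem ddiff_stepSq : ddiff a c₃ c (stepSq a c₃ c) =
    C (2 * a * (a ^ 2 - 1)) * (X - C c₃) := by
  rw [stepSq, ddiff_C_mul, map_sub (ddiff a c₃ c), pow_two (X - C c₃), ddiff_centered_mul]
  simp [C_ofNat]; ring

theorem centered_induction {p : ℂ[X] → Prop} (hone : p 1) (hadd : ∀ f g, p f → p g → p (f + g))
    (hC : ∀ r f, p f → p (C r * f)) (hmul : ∀ f, p f → p ((X - C c₃) * f)) (f : ℂ[X]) : p f := by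
  induction f using Polynomial.induction_on with
  | C r => simpa using hC r 1 hone
  | add f g hf hg => exact hadd f g hf hg
  | monomial n r h =>
    have : C r * X ^ (n + 1) = (X - C c₃) * (C r * X ^ n) + C c₃ * (C r * X ^ n) := by ring
    rw [this]
    exact hadd _ _ (hmul _ h) (hC _ _ h)

theorem ddiff_avg_and_avg_avg (f : ℂ[X]) :
    ddiff a c₃ c (avg a c₃ c f) = C a * avg a c₃ c (ddiff a c₃ c f) +
      C (a ^ 2 - 1) * (X - C c₃) * ddiff a c₃ c (ddiff a c₃ c f) ∧
    avg a c₃ c (avg a c₃ c f) = f + C (a ^ 2 - 1) * (X - C c₃) * avg a c₃ c (ddiff a c₃ c f) +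
      C a * stepSq a c₃ c * ddiff a c₃ c (ddiff a c₃ c f) := by
  induction f using centered_induction c₃ with
  | hone =>
    have h1 : avg a c₃ c 1 = 1 := by simpa using avg_C a c₃ c 1
    have h2 : ddiff a c₃ c 1 = 0 := by simpa using ddiff_C a c₃ c 1
    simp [h1, h2]
  | hadd f g hf hg =>
    simp only [map_add, hf.1, hf.2, hg.1, hg.2]
    constructor <;> ring
  | hC r f hf =>
    simp only [avg_C_mul, ddiff_C_mul, hf.1, hf.2]
    constructor <;> ring
  | hmul f hf =>
    obtain ⟨h1, h2⟩ := hf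
    have e1 := avg_stepSq a c₃ c
    have e2 := ddiff_stepSq a c₃ c
    simp only [avg_centered_mul, ddiff_centered_mul, map_add, avg_mul a c₃ c (stepSq a c₃ c),
      ddiff_mul a c₃ c (stepSq a c₃ c), mul_assoc (C a), avg_C_mul, ddiff_C_mul, e1, e2, h1, h2]
    simp only [stepSq, map_sub, map_pow, map_one, map_mul, C_ofNat]
    constructor <;> ring

theorem ddiff_avg (f : ℂ[X]) :
    ddiff a c₃ c (avg a c₃ c f) = C a * avg a c₃ c (ddiff a c₃ c f) +
      C (a ^ 2 - 1) * (X - C c₃) * ddiff a c₃ c (ddiff a c₃ c f) :=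
  (ddiff_avg_and_avg_avg a c₃ c f).1

theorem iterate_C_mul (k : ℕ) (r : ℂ) (f : ℂ[X]) :
    (ddiff a c₃ c)^[k] (C r * f) = C r * (ddiff a c₃ c)^[k] f := by
  induction k with
  | zero => rfl
  | succ k ih => simp only [Function.iterate_succ_apply', ih, ddiff_C_mul]

theorem iterate_avg (k : ℕ) (f : ℂ[X]) :
    (ddiff a c₃ c)^[k] (avg a c₃ c f) =
      C (coeffSeq a k).1 * avg a c₃ c ((ddiff a c₃ c)^[k] f) +
      C ((a ^ 2 - 1) * (coeffSeq a k).2) * (X - C c₃) * (ddiff a c₃ c)^[k + 1] f := by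
  induction k with
  | zero => simp [coeffSeq]
  | succ k ih =>
    rw [Function.iterate_succ_apply', ih]
    simp only [map_add, mul_assoc, ddiff_C_mul, ddiff_centered_mul, ddiff_avg,
      Function.iterate_succ_apply', coeffSeq]
    simp only [map_sub, map_pow, map_one, map_mul, map_add]
    ring

theorem iterate_centered_mul (k : ℕ) (f : ℂ[X]) :
    (ddiff a c₃ c)^[k + 1] ((X - C c₃) * f) =
      C (coeffSeq a (k + 1)).1 * (X - C c₃) * (ddiff a c₃ c)^[k + 1] f +
      C (coeffSeq a (k + 1)).2 * avg a c₃ c ((ddiff a c₃ c)^[k] f) := by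
  induction k with
  | zero => simp [coeffSeq, ddiff_centered_mul]; ring
  | succ k ih =>
    rw [Function.iterate_succ_apply', ih, coeffSeq_succ a (k + 1)]
    simp only [map_add, mul_assoc, ddiff_C_mul, ddiff_centered_mul, ddiff_avg,
      Function.iterate_succ_apply']
    simp only [map_sub, map_pow, map_one, map_mul]
    ring

theorem iterate_centered_mul_ddiff (k : ℕ) (f : ℂ[X]) :
    C (coeffSeq a k).1 * (ddiff a c₃ c)^[k] ((X - C c₃) * ddiff a c₃ c f) =
      (X - C c₃) * (ddiff a c₃ c)^[k] (ddiff a c₃ c f) +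
      C (coeffSeq a k).2 * (ddiff a c₃ c)^[k] (avg a c₃ c f) := by
  rw [iterate_avg]
  cases k with
  | zero => simp [coeffSeq]
  | succ k =>
    have h := congrArg (C : ℂ → ℂ[X]) (coeffSeq_sq a (k + 1))
    simp only [map_sub, map_pow, map_mul, map_one] at h
    rw [iterate_centered_mul]
    simp only [← Function.iterate_succ_apply, map_sub, map_pow, map_mul, map_one]
    linear_combination ((X - C c₃) * (ddiff a c₃ c)^[k + 1 + 1] f) * h

/-- Elements of the step algebra whose real and imaginary parts have degrees at most `n + 1`
and `n`. -/
def InRange {a c₃ c : ℂ} (n : ℕ) (κ : StepAlgebra a c₃ c) : Prop :=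
  κ.re.natDegree ≤ n + 1 ∧ κ.im.natDegree ≤ n

theorem natDegree_stepSq_le : (stepSq a c₃ c).natDegree ≤ 2 := by
  unfold stepSq; compute_degree

theorem coeff_stepSq_two : (stepSq a c₃ c).coeff 2 = a ^ 2 - 1 := by
  unfold stepSq; compute_degree!

theorem natDegree_avg_X_le : (avg a c₃ c X).natDegree ≤ 1 := by
  rw [avg_X]; compute_degree

theorem coeff_avg_X_one : (avg a c₃ c X).coeff 1 = a := by
  rw [avg_X]; compute_degree!

variable {a c₃ c}

theorem shift_X_mul_re (κ : StepAlgebra a c₃ c) :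
    (shift a c₃ c X * κ).re = avg a c₃ c X * κ.re + stepSq a c₃ c * κ.im := by
  simp

theorem shift_X_mul_im (κ : StepAlgebra a c₃ c) :
    (shift a c₃ c X * κ).im = avg a c₃ c X * κ.im + κ.re := by
  simp

theorem InRange.shift_X_mul {n : ℕ} {κ : StepAlgebra a c₃ c} (h : InRange n κ) :
    InRange (n + 1) (shift a c₃ c X * κ) ∧
    (shift a c₃ c X * κ).re.coeff (n + 2) = a * κ.re.coeff (n + 1) + (a ^ 2 - 1) * κ.im.coeff n ∧
    (shift a c₃ c X * κ).im.coeff (n + 1) = κ.re.coeff (n + 1) + a * κ.im.coeff n := by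
  have h1 := natDegree_avg_X_le a c₃ c
  have h2 := natDegree_stepSq_le a c₃ c
  refine ⟨⟨?_, ?_⟩, ?_, ?_⟩
  · rw [shift_X_mul_re]
    refine natDegree_add_le_of_degree_le ?_ ?_
    · exact natDegree_mul_le.trans (by have := h.1; omega)
    · exact natDegree_mul_le.trans (by have := h.2; omega)
  · rw [shift_X_mul_im]
    refine natDegree_add_le_of_degree_le ?_ h.1
    exact natDegree_mul_le.trans (by have := h.2; omega)
  · rw [shift_X_mul_re, coeff_add, show n + 2 = 1 + (n + 1) by ring,
      coeff_mul_add_eq_of_natDegree_le h1 h.1, coeff_avg_X_one, show 1 + (n + 1) = 2 + n by ring,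
      coeff_mul_add_eq_of_natDegree_le h2 h.2, coeff_stepSq_two]
  · rw [shift_X_mul_im, coeff_add, add_comm n 1, coeff_mul_add_eq_of_natDegree_le h1 h.2,
      coeff_avg_X_one, add_comm]

theorem InRange.shift_X_pow_mul {n : ℕ} {κ : StepAlgebra a c₃ c} (h : InRange n κ) (m : ℕ) :
    InRange (n + m) (shift a c₃ c (X ^ m) * κ) := by
  induction m with
  | zero => simpa using h
  | succ m ih =>
    rw [pow_succ', map_mul, mul_assoc]
    exact ih.shift_X_mul.1

theorem InRange.of_le {n m : ℕ} {κ : StepAlgebra a c₃ c} (h : InRange n κ) (hnm : n ≤ m) :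
    InRange m κ :=
  ⟨h.1.trans (by omega), h.2.trans hnm⟩

theorem InRange.add {n : ℕ} {κ η : StepAlgebra a c₃ c} (h : InRange n κ) (h' : InRange n η) :
    InRange n (κ + η) :=
  ⟨natDegree_add_le_of_degree_le h.1 h'.1, natDegree_add_le_of_degree_le h.2 h'.2⟩

theorem InRange.smul {n : ℕ} {κ : StepAlgebra a c₃ c} (h : InRange n κ) (r : ℂ) :
    InRange n (r • κ) :=
  ⟨(natDegree_smul_le _ _).trans h.1, (natDegree_smul_le _ _).trans h.2⟩

theorem natDegree_le_of_coeff_succ {n : ℕ} {f : ℂ[X]} (h : f.natDegree ≤ n + 1)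
    (h' : f.coeff (n + 1) = 0) : f.natDegree ≤ n := by
  by_contra hn
  have hd : f.natDegree = n + 1 := by omega
  rw [← hd, coeff_natDegree, leadingCoeff_eq_zero] at h'
  simp [h'] at hd

theorem InRange.pred {n : ℕ} {κ : StepAlgebra a c₃ c} (h : InRange (n + 1) κ)
    (hre : κ.re.coeff (n + 2) = 0) (him : κ.im.coeff (n + 1) = 0) : InRange n κ :=
  ⟨natDegree_le_of_coeff_succ h.1 hre, natDegree_le_of_coeff_succ h.2 him⟩

theorem inRange_shift {n : ℕ} {f : ℂ[X]} (hf : f.natDegree ≤ n + 1) :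
    InRange n (shift a c₃ c f) ∧
    (avg a c₃ c f).coeff (n + 1) = (coeffSeq a (n + 1)).1 * f.coeff (n + 1) ∧
    (ddiff a c₃ c f).coeff n = (coeffSeq a (n + 1)).2 * f.coeff (n + 1) := by
  induction n generalizing f with
  | zero =>
    obtain ⟨r, t, rfl⟩ := exists_eq_X_add_C_of_natDegree_le_one hf
    have e1 : avg a c₃ c (C r * X + C t) = C r * (C a * (X - C c₃) + C c₃) + C t := by
      rw [map_add, avg_C_mul, avg_X, avg_C]
    have e2 : ddiff a c₃ c (C r * X + C t) = C r := by
      rw [map_add, ddiff_C_mul, ddiff_X, ddiff_C]; simp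
    refine ⟨⟨?_, ?_⟩, ?_, ?_⟩
    · rw [re_shift, e1]; compute_degree
    · rw [im_shift, e2]; simp
    · rw [e1]; simp [coeffSeq, coeff_C, coeff_X]; ring
    · rw [e2]; simp [coeffSeq]
  | succ n ih =>
    have hd : f.divX.natDegree ≤ n + 1 := by
      rw [natDegree_divX_eq_natDegree_tsub_one]; omega
    obtain ⟨h1, h2, h3⟩ := ih hd
    obtain ⟨h4, h5, h6⟩ := h1.shift_X_mul
    have hf' : shift a c₃ c f = shift a c₃ c X * shift a c₃ c f.divX +
        shift a c₃ c (C (f.coeff 0)) := by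
      rw [← map_mul, ← map_add, X_mul_divX_add]
    have hC : InRange (n + 1) (shift a c₃ c (C (f.coeff 0))) :=
      ⟨by simp, by simp⟩
    refine ⟨hf' ▸ h4.add hC, ?_, ?_⟩
    · rw [← re_shift, hf', QuadraticAlgebra.re_add, coeff_add, h5, re_shift, im_shift, h2, h3,
        re_shift, avg_C, coeff_C, coeff_divX, coeffSeq_succ a (n + 1)]
      simp; ring
    · rw [← im_shift, hf', QuadraticAlgebra.im_add, coeff_add, h6, re_shift, im_shift, h2, h3,
        im_shift, ddiff_C, coeff_divX, coeffSeq_succ a (n + 1)]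
      simp; ring

theorem exists_coeff_iterate_ddiff (hγ : ∀ n, (coeffSeq a (n + 1)).2 ≠ 0) (k m : ℕ) :
    ∃ r : ℂ, r ≠ 0 ∧ ∀ f : ℂ[X], f.natDegree ≤ m + k →
      ((ddiff a c₃ c)^[k] f).natDegree ≤ m ∧
      ((ddiff a c₃ c)^[k] f).coeff m = r * f.coeff (m + k) := by
  induction k with
  | zero => exact ⟨1, one_ne_zero, fun f hf => by simpa using hf⟩
  | succ k ih =>
    obtain ⟨r, hr, h⟩ := ih
    refine ⟨r * (coeffSeq a (m + k + 1)).2, mul_ne_zero hr (hγ _), fun f hf => ?_⟩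
    obtain ⟨h1, -, h3⟩ := inRange_shift (c₃ := c₃) (c := c) (a := a) (n := m + k) hf
    obtain ⟨h4, h5⟩ := h _ h1.2
    refine ⟨h4, ?_⟩
    rw [Function.iterate_succ_apply, ← im_shift, h5, im_shift, h3]
    ring_nf

theorem iterate_ddiff_eq_zero (hγ : ∀ n, (coeffSeq a (n + 1)).2 ≠ 0) {k : ℕ} {f : ℂ[X]}
    (hf : f.natDegree < k) : (ddiff a c₃ c)^[k] f = 0 := by
  obtain ⟨k, rfl⟩ : ∃ l, k = l + 1 := ⟨k - 1, by omega⟩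
  obtain ⟨r, -, h⟩ := exists_coeff_iterate_ddiff (c₃ := c₃) (c := c) hγ k 0
  have := (h f (by omega)).1
  rw [Function.iterate_succ_apply', eq_C_of_natDegree_le_zero this, ddiff_C]

theorem surjective_of_coeff {T : ℂ[X] →ₗ[ℂ] ℂ[X]} (d : ℕ)
    (h : ∀ n, ∃ r : ℂ, r ≠ 0 ∧ ∀ f : ℂ[X], f.natDegree ≤ n + d →
      (T f).natDegree ≤ n ∧ (T f).coeff n = r * f.coeff (n + d)) :
    Function.Surjective T := by
  have key : ∀ n, ∀ g : ℂ[X], g.natDegree ≤ n → ∃ f, T f = g := by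
    intro n
    induction n with
    | zero =>
      intro g hg
      obtain ⟨r, hr, h⟩ := h 0
      obtain ⟨h1, h2⟩ := h (C (r⁻¹ * g.coeff 0) * X ^ (0 + d)) (natDegree_C_mul_X_pow_le _ _)
      exact ⟨_, by rw [eq_C_of_natDegree_le_zero h1, h2, coeff_C_mul_X_pow, if_pos rfl,
        mul_inv_cancel_left₀ hr, ← eq_C_of_natDegree_le_zero hg]⟩
    | succ n ih =>
      intro g hg
      obtain ⟨r, hr, h⟩ := h (n + 1)
      set f := C (r⁻¹ * g.coeff (n + 1)) * X ^ (n + 1 + d) with hf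
      obtain ⟨h1, h2⟩ := h f (natDegree_C_mul_X_pow_le _ _)
      obtain ⟨f', hf'⟩ := ih (g - T f) (natDegree_le_of_coeff_succ
        ((natDegree_sub_le_of_le hg h1).trans (max_self _).le) (by
          rw [coeff_sub, h2, hf, coeff_C_mul_X_pow, if_pos rfl, mul_inv_cancel_left₀ hr, sub_self]))
      exact ⟨f' + f, by rw [map_add, hf', sub_add_cancel]⟩
  exact fun g => key _ g le_rfl

theorem ddiff_surjective (hγ : ∀ n, (coeffSeq a (n + 1)).2 ≠ 0) :
    Function.Surjective (ddiff a c₃ c) :=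
  surjective_of_coeff 1 fun n => by
    simpa using exists_coeff_iterate_ddiff (c₃ := c₃) (c := c) hγ 1 n

theorem avg_surjective (hα : ∀ n, (coeffSeq a n).1 ≠ 0) :
    Function.Surjective (avg a c₃ c) :=
  surjective_of_coeff 0 fun n => ⟨(coeffSeq a n).1, hα n, fun f hf => by
    cases n with
    | zero =>
      obtain ⟨r, rfl⟩ : ∃ r, f = C r := ⟨_, eq_C_of_natDegree_le_zero hf⟩
      simp [coeffSeq]
    | succ n =>
      obtain ⟨h1, h2, -⟩ := inRange_shift (c₃ := c₃) (c := c) (a := a) (n := n) hf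
      exact ⟨h1.1, h2⟩⟩

/-- `P` is the monic orthogonal polynomial sequence of `u`. -/
structure IsMonicOPS (u : ℂ[X] →ₗ[ℂ] ℂ) (P : ℕ → ℂ[X]) : Prop where
  monic : ∀ n, (P n).Monic
  natDegree_eq : ∀ n, (P n).natDegree = n
  orthogonal : ∀ n m, n ≠ m → u (P n * P m) = 0
  norm_ne_zero : ∀ n, u (P n * P n) ≠ 0

namespace IsMonicOPS

variable {u : ℂ[X] →ₗ[ℂ] ℂ} {P : ℕ → ℂ[X]}

theorem map_C_mul (u : ℂ[X] →ₗ[ℂ] ℂ) (r : ℂ) (f : ℂ[X]) : u (C r * f) = r * u f := by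
  rw [← smul_eq_C_mul, map_smul, smul_eq_mul]

theorem coeff_eq_one (h : IsMonicOPS u P) (n : ℕ) : (P n).coeff n = 1 := by
  have := (h.monic n).coeff_natDegree
  rwa [h.natDegree_eq] at this

/-- Removing the leading term of `f` lowers its degree. -/
theorem exists_eq_add (h : IsMonicOPS u P) {n : ℕ} {f : ℂ[X]} (hf : f.natDegree ≤ n + 1) :
    ∃ g : ℂ[X], g.natDegree ≤ n ∧ f = g + C (f.coeff (n + 1)) * P (n + 1) := by
  refine ⟨f - C (f.coeff (n + 1)) * P (n + 1), natDegree_le_of_coeff_succ ?_ ?_, by ring⟩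
  · refine (natDegree_sub_le_of_le hf ((natDegree_C_mul_le _ _).trans
      (h.natDegree_eq _).le)).trans (max_self _).le
  · simp [h.coeff_eq_one]

theorem eq_one (h : IsMonicOPS u P) : P 0 = 1 :=
  (h.monic 0).natDegree_eq_zero.mp (h.natDegree_eq 0)

theorem induction (h : IsMonicOPS u P) {p : ℂ[X] → Prop} (n : ℕ) (hP : ∀ m ≤ n, p (P m))
    (hadd : ∀ f g, p f → p g → p (f + g)) (hC : ∀ r f, p f → p (C r * f)) {f : ℂ[X]}
    (hf : f.natDegree ≤ n) : p f := by
  induction n generalizing f with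
  | zero =>
    have h0 := hC (f.coeff 0) _ (hP 0 le_rfl)
    rwa [h.eq_one, mul_one, ← eq_C_of_natDegree_le_zero hf] at h0
  | succ n ih =>
    obtain ⟨g, hg, hfg⟩ := h.exists_eq_add hf
    rw [hfg]
    exact hadd _ _ (ih (fun m hm => hP m (by omega)) hg) (hC _ _ (hP _ le_rfl))

theorem apply_of_natDegree_lt (h : IsMonicOPS u P) {n : ℕ} {g : ℂ[X]} (hg : g.natDegree < n) :
    u (P n * g) = 0 := by
  refine h.induction (p := fun g => u (P n * g) = 0) (n - 1)
    (fun m hm => h.orthogonal _ _ (by omega)) (fun f g hf hg => ?_) (fun r f hf => ?_) (by omega)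
  · rw [mul_add, map_add, hf, hg, add_zero]
  · rw [mul_left_comm, map_C_mul, hf, mul_zero]

theorem apply_of_natDegree_le (h : IsMonicOPS u P) {n : ℕ} {g : ℂ[X]} (hg : g.natDegree ≤ n) :
    u (P n * g) = g.coeff n * u (P n * P n) := by
  cases n with
  | zero =>
    rw [h.eq_one, one_mul, eq_C_of_natDegree_le_zero hg, ← mul_one (C _), map_C_mul]
    simp
  | succ n =>
    obtain ⟨f, hf, hfg⟩ := h.exists_eq_add hg
    nth_rw 1 [hfg]
    rw [mul_add, map_add, h.apply_of_natDegree_lt (by omega), mul_left_comm, map_C_mul, zero_add]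

theorem eq_zero_of_apply (h : IsMonicOPS u P) {f : ℂ[X]}
    (hf : ∀ g : ℂ[X], g.natDegree ≤ f.natDegree → u (f * g) = 0) : f = 0 := by
  have h1 := hf (P f.natDegree) (h.natDegree_eq _).le
  rw [mul_comm, h.apply_of_natDegree_le le_rfl, coeff_natDegree] at h1
  exact leadingCoeff_eq_zero.mp ((mul_eq_zero.mp h1).resolve_right (h.norm_ne_zero _))

end IsMonicOPS

open IsMonicOPS

variable {u v : ℂ[X] →ₗ[ℂ] ℂ} {P : ℕ → ℂ[X]}

theorem exists_transfer_basis (hγ : ∀ n, (coeffSeq a (n + 1)).2 ≠ 0) (hu : IsMonicOPS u P) {k : ℕ}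
    {s : ℕ → ℂ} (hs : ∀ n, s n ≠ 0)
    (horth : ∀ n m, n ≠ m → v (C (s n) * (ddiff a c₃ c)^[k] (P (n + k)) *
      (C (s m) * (ddiff a c₃ c)^[k] (P (m + k)))) = 0)
    (hnorm : ∀ n, v ((C (s n) * (ddiff a c₃ c)^[k] (P (n + k))) ^ 2) ≠ 0) (n : ℕ) :
    ∃ t : ℂ, t ≠ 0 ∧ ∀ f, v ((ddiff a c₃ c)^[k] (P (n + k)) * (ddiff a c₃ c)^[k] f) =
      u (C t * P (n + k) * f) := by
  set Q : ℕ → ℂ[X] := fun n => (ddiff a c₃ c)^[k] (P (n + k)) with hQ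
  have horth' : ∀ m, n ≠ m → v (Q n * Q m) = 0 := fun m hm => by
    have := horth n m hm
    rw [mul_mul_mul_comm, ← C_mul, map_C_mul] at this
    exact (mul_eq_zero.mp this).resolve_left (mul_ne_zero (hs _) (hs _))
  have hnorm' : v (Q n * Q n) ≠ 0 := fun h0 => hnorm n (by
    rw [mul_pow, ← C_pow, map_C_mul, pow_two ((ddiff a c₃ c)^[k] (P (n + k)))]
    exact mul_eq_zero_of_right _ h0)
  set t := v (Q n * Q n) / u (P (n + k) * P (n + k)) with ht
  refine ⟨t, div_ne_zero hnorm' (hu.norm_ne_zero _), fun f => hu.induction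
      (p := fun f => v (Q n * (ddiff a c₃ c)^[k] f) = u (C t * P (n + k) * f))
      f.natDegree (fun m _ => ?_) (fun f g hf hg => ?_) (fun r f hf => ?_) le_rfl⟩
  · rw [mul_assoc, map_C_mul]
    rcases lt_or_ge m k with hm | hm
    · rw [iterate_ddiff_eq_zero hγ (by rwa [hu.natDegree_eq]), mul_zero, map_zero,
        hu.orthogonal (n + k) m (by omega), mul_zero]
    · obtain ⟨m, rfl⟩ := Nat.exists_eq_add_of_le' hm
      by_cases hnm : n = m
      · subst hnm
        rw [ht, div_mul_cancel₀ _ (hu.norm_ne_zero _)]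
      · rw [hu.orthogonal (n + k) (m + k) (by omega), mul_zero]
        exact horth' m hnm
  · rw [iterate_map_add, mul_add, map_add, hf, hg, mul_add, map_add]
  · rw [iterate_C_mul, mul_left_comm, map_C_mul, hf, mul_left_comm, map_C_mul]

/-- If the derivatives of order `k` are orthogonal for `v`, then multiplying `v` by a polynomial `r`
corresponds to multiplying `u` by a polynomial of degree exactly `deg r + k`. -/
theorem exists_transfer (hγ : ∀ n, (coeffSeq a (n + 1)).2 ≠ 0) (hu : IsMonicOPS u P) {k : ℕ}
    (hbasis : ∀ n, ∃ t : ℂ, t ≠ 0 ∧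
      ∀ f, v ((ddiff a c₃ c)^[k] (P (n + k)) * (ddiff a c₃ c)^[k] f) = u (C t * P (n + k) * f))
    (n : ℕ) {r : ℂ[X]} (hr : r.natDegree ≤ n) :
    ∃ A : ℂ[X], A.natDegree ≤ n + k ∧ (r.coeff n ≠ 0 → A.coeff (n + k) ≠ 0) ∧
      ∀ f, v (r * (ddiff a c₃ c)^[k] f) = u (A * f) := by
  have step : ∀ n, ∃ Q B : ℂ[X], Q.natDegree ≤ n ∧ Q.coeff n = 1 ∧ B.natDegree ≤ n + k ∧
      B.coeff (n + k) ≠ 0 ∧ ∀ f, v (Q * (ddiff a c₃ c)^[k] f) = u (B * f) := by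
    intro n
    obtain ⟨t, ht, h⟩ := hbasis n
    obtain ⟨l, hl, hl'⟩ := exists_coeff_iterate_ddiff (c₃ := c₃) (c := c) hγ k n
    obtain ⟨h1, h2⟩ := hl' (P (n + k)) (hu.natDegree_eq _).le
    rw [hu.coeff_eq_one, mul_one] at h2
    refine ⟨C l⁻¹ * (ddiff a c₃ c)^[k] (P (n + k)), C (l⁻¹ * t) * P (n + k),
      (natDegree_C_mul_le _ _).trans h1, ?_, (natDegree_C_mul_le _ _).trans (hu.natDegree_eq _).le,
      ?_, fun f => ?_⟩
    · rw [coeff_C_mul, h2, inv_mul_cancel₀ hl]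
    · rw [coeff_C_mul, hu.coeff_eq_one, mul_one]
      exact mul_ne_zero (inv_ne_zero hl) ht
    · rw [mul_assoc, map_C_mul, h, mul_assoc, mul_assoc, map_C_mul, map_C_mul, mul_assoc]
  induction n generalizing r with
  | zero =>
    obtain ⟨Q, B, hQ, hQ1, hB, hB1, h⟩ := step 0
    have hQ' : Q = 1 := by rw [eq_C_of_natDegree_le_zero hQ, hQ1, C_1]
    refine ⟨C (r.coeff 0) * B, (natDegree_C_mul_le _ _).trans hB, fun h0 => ?_, fun f => ?_⟩
    · rw [coeff_C_mul]; exact mul_ne_zero h0 hB1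
    · rw [mul_assoc, map_C_mul, ← h, ← map_C_mul, ← mul_assoc, hQ', mul_one,
        ← eq_C_of_natDegree_le_zero hr]
  | succ n ih =>
    obtain ⟨Q, B, hQ, hQ1, hB, hB1, h⟩ := step (n + 1)
    have hr' : (r - C (r.coeff (n + 1)) * Q).natDegree ≤ n :=
      natDegree_le_of_coeff_succ ((natDegree_sub_le_of_le hr
        ((natDegree_C_mul_le _ _).trans hQ)).trans (max_self _).le) (by simp [hQ1])
    obtain ⟨A, hA, -, h'⟩ := ih hr'
    refine ⟨A + C (r.coeff (n + 1)) * B, natDegree_add_le_of_degree_le (by omega)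
      ((natDegree_C_mul_le _ _).trans hB), fun h0 => ?_, fun f => ?_⟩
    · rw [coeff_add, coeff_eq_zero_of_natDegree_lt (by omega), zero_add, coeff_C_mul]
      exact mul_ne_zero h0 hB1
    · rw [add_mul, map_add, ← h', mul_assoc, map_C_mul, ← h, ← map_C_mul, ← map_add]
      congr 1; ring


/-- The element `κ = φ + ψ ω` encodes a Pearson equation `u (φ D f + ψ S f) = 0`. -/
def IsPearson (u : ℂ[X] →ₗ[ℂ] ℂ) (κ : StepAlgebra a c₃ c) : Prop :=
  ∀ f, u ((κ * shift a c₃ c f).im) = 0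

theorem im_mul_shift (κ : StepAlgebra a c₃ c) (f : ℂ[X]) :
    (κ * shift a c₃ c f).im = κ.re * ddiff a c₃ c f + κ.im * avg a c₃ c f := by
  simp

theorem IsPearson.add {κ η : StepAlgebra a c₃ c} (h : IsPearson u κ) (h' : IsPearson u η) :
    IsPearson u (κ + η) := fun f => by
  rw [add_mul, QuadraticAlgebra.im_add, map_add, h, h', add_zero]

theorem IsPearson.shift_mul {κ : StepAlgebra a c₃ c} (h : IsPearson u κ) (g : ℂ[X]) :
    IsPearson u (shift a c₃ c g * κ) := fun f => by
  rw [mul_comm (shift a c₃ c g), mul_assoc, ← map_mul, h]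

theorem shift_C_mul (r : ℂ) (κ : StepAlgebra a c₃ c) : shift a c₃ c (C r) * κ = r • κ := by
  rw [← algebraMap_eq, AlgHom.commutes, Algebra.smul_def]

theorem IsPearson.smul {κ : StepAlgebra a c₃ c} (h : IsPearson u κ) (r : ℂ) :
    IsPearson u (r • κ) := shift_C_mul r κ ▸ h.shift_mul (C r)

/-- The determinant of the leading coefficients of two elements of degree `n`. -/
noncomputable def leadDet (n : ℕ) (κ η : StepAlgebra a c₃ c) : ℂ :=
  κ.re.coeff (n + 1) * η.im.coeff n - κ.im.coeff n * η.re.coeff (n + 1)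

theorem leadDet_shift_X_pow {n : ℕ} {κ η : StepAlgebra a c₃ c} (hκ : InRange n κ)
    (hη : InRange n η) (m : ℕ) : leadDet (n + m) (shift a c₃ c (X ^ m) * κ)
      (shift a c₃ c (X ^ m) * η) = leadDet n κ η := by
  induction m with
  | zero => simp
  | succ m ih =>
    rw [← ih, pow_succ', map_mul, mul_assoc, mul_assoc]
    obtain ⟨-, h1, h2⟩ := (hκ.shift_X_pow_mul m).shift_X_mul
    obtain ⟨-, h3, h4⟩ := (hη.shift_X_pow_mul m).shift_X_mul
    rw [← add_assoc, leadDet, leadDet, show n + m + 1 + 1 = n + m + 2 from rfl, h1, h2, h3, h4]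
    ring

theorem avg_injective (hα : ∀ n, (coeffSeq a n).1 ≠ 0) {f : ℂ[X]} (hf : avg a c₃ c f = 0) :
    f = 0 := by
  rcases hd : f.natDegree with _ | n
  · rw [eq_C_of_natDegree_le_zero hd.le, avg_C] at hf
    rw [eq_C_of_natDegree_le_zero hd.le, hf]
  · have h := (inRange_shift (c₃ := c₃) (c := c) (a := a) hd.le).2.1
    rw [hf, coeff_zero, ← hd, coeff_natDegree] at h
    exact leadingCoeff_eq_zero.mp ((mul_eq_zero.mp h.symm).resolve_left (hα _))

theorem exists_orthogonal_inRange (u : ℂ[X] →ₗ[ℂ] ℂ) (n : ℕ) : ∃ f : ℂ[X], f ≠ 0 ∧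
    ∀ ζ : StepAlgebra a c₃ c, InRange n ζ → u ((ζ * shift a c₃ c f).im) = 0 := by
  let W := degreeLT ℂ (n + 2)
  let T : ℂ[X] →ₗ[ℂ] (W →ₗ[ℂ] ℂ) × (W →ₗ[ℂ] ℂ) :=
    { toFun f := ((u.comp (LinearMap.mulRight ℂ (ddiff a c₃ c f))).domRestrict W,
        (u.comp (LinearMap.mulRight ℂ (avg a c₃ c f))).domRestrict W)
      map_add' f g := by ext <;> simp [mul_add]
      map_smul' r f := by ext <;> simp }
  have hT : ¬ Function.Injective T := fun h =>
    Polynomial.not_finite (R := ℂ) (Module.Finite.of_injective T h)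
  rw [injective_iff_map_eq_zero] at hT
  push Not at hT
  obtain ⟨f, hf, hf0⟩ := hT
  refine ⟨f, hf0, fun ζ hζ => ?_⟩
  have hmem : ∀ p : ℂ[X], p.natDegree ≤ n + 1 → p ∈ W := fun p hp => by
    rw [mem_degreeLT]
    exact degree_le_natDegree.trans_lt (by exact_mod_cast (by omega : p.natDegree < n + 2))
  have h1 := LinearMap.congr_fun (congrArg Prod.fst hf) ⟨ζ.re, hmem _ hζ.1⟩
  have h2 := LinearMap.congr_fun (congrArg Prod.snd hf) ⟨ζ.im, hmem _ (hζ.2.trans (by omega))⟩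
  rw [im_mul_shift, map_add]
  have h1' : u (ζ.re * ddiff a c₃ c f) = 0 := h1
  have h2' : u (ζ.im * avg a c₃ c f) = 0 := h2
  rw [h1', h2', add_zero]

/-- The leading coefficients of two Pearson equations of the same degree are proportional. -/
theorem IsPearson.leadDet_eq_zero (hα : ∀ n, (coeffSeq a n).1 ≠ 0) (hu : IsMonicOPS u P)
    {n : ℕ} {κ η : StepAlgebra a c₃ c} (hκ : IsPearson u κ) (hη : IsPearson u η)
    (hκn : InRange n κ) (hηn : InRange n η) : leadDet n κ η = 0 := by
  by_contra hdet
  obtain ⟨f, hf0, hf⟩ := exists_orthogonal_inRange (a := a) (c₃ := c₃) (c := c) u n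
  have key : ∀ m, ∀ ζ : StepAlgebra a c₃ c, InRange (n + m) ζ →
      u ((ζ * shift a c₃ c f).im) = 0 := by
    intro m
    induction m with
    | zero => exact hf
    | succ m ih =>
      intro ζ hζ
      set κ' := shift a c₃ c (X ^ (m + 1)) * κ with hκ'
      set η' := shift a c₃ c (X ^ (m + 1)) * η with hη'
      have hd : leadDet (n + (m + 1)) κ' η' ≠ 0 := by
        rwa [leadDet_shift_X_pow hκn hηn]
      have hκm := hκn.shift_X_pow_mul (m + 1)
      have hηm := hηn.shift_X_pow_mul (m + 1)
      rw [← hκ'] at hκm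
      rw [← hη'] at hηm
      set r := leadDet (n + (m + 1)) ζ η' / leadDet (n + (m + 1)) κ' η' with hr
      set t := leadDet (n + (m + 1)) κ' ζ / leadDet (n + (m + 1)) κ' η' with ht
      have hsmall : InRange (n + m) (ζ + ((-r) • κ' + (-t) • η')) := by
        refine InRange.pred (hζ.add ((hκm.smul _).add (hηm.smul _))) ?_ ?_
        · simp only [QuadraticAlgebra.re_add, QuadraticAlgebra.re_smul, coeff_add, coeff_smul,
            smul_eq_mul, hr, ht]
          field_simp
          simp only [leadDet, ← add_assoc]
          ring
        · simp only [QuadraticAlgebra.im_add, QuadraticAlgebra.im_smul, coeff_add, coeff_smul,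
            smul_eq_mul, hr, ht]
          field_simp
          simp only [leadDet, ← add_assoc]
          ring
      have h1 := ih _ hsmall
      have h2 := (((hκ.shift_mul (X ^ (m + 1))).smul (-r)).add
        ((hη.shift_mul (X ^ (m + 1))).smul (-t))) f
      rwa [add_mul, QuadraticAlgebra.im_add, map_add, h2, add_zero] at h1
  refine hf0 (avg_injective (c₃ := c₃) (c := c) hα (hu.eq_zero_of_apply fun g _ => ?_))
  have := key g.natDegree ⟨0, g⟩ ⟨by simp, by simp⟩
  rwa [im_mul_shift, zero_mul, zero_add, mul_comm] at this

theorem IsPearson.eq_zero_of_im (hγ : ∀ n, (coeffSeq a (n + 1)).2 ≠ 0) (hu : IsMonicOPS u P)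
    {κ : StepAlgebra a c₃ c} (hκ : IsPearson u κ) (him : κ.im = 0) : κ = 0 := by
  refine QuadraticAlgebra.ext (hu.eq_zero_of_apply fun g _ => ?_) him
  obtain ⟨f, rfl⟩ := ddiff_surjective (c₃ := c₃) (c := c) hγ g
  have := hκ f
  rwa [im_mul_shift, him, zero_mul, add_zero] at this

theorem IsPearson.eq_zero_of_re (hα : ∀ n, (coeffSeq a n).1 ≠ 0) (hu : IsMonicOPS u P)
    {κ : StepAlgebra a c₃ c} (hκ : IsPearson u κ) (hre : κ.re = 0) : κ = 0 := by
  refine QuadraticAlgebra.ext hre (hu.eq_zero_of_apply fun g _ => ?_)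
  obtain ⟨f, rfl⟩ := avg_surjective (c₃ := c₃) (c := c) hα g
  have := hκ f
  rwa [im_mul_shift, hre, zero_mul, zero_add] at this

theorem IsPearson.eq_zero_of_lead_eq_zero (hγ : ∀ n, (coeffSeq a (n + 1)).2 ≠ 0)
    (hu : IsMonicOPS u P) {κ : StepAlgebra a c₃ c} (hκ : IsPearson u κ) {n : ℕ}
    (hn : InRange n κ) (hre : κ.re.coeff (n + 1) = 0) (him : κ.im.coeff n = 0)
    (hlow : ∀ m, m < n → InRange m κ → κ = 0) : κ = 0 := by
  cases n with
  | zero =>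
    refine hκ.eq_zero_of_im hγ hu ?_
    rw [eq_C_of_natDegree_le_zero hn.2, him, C_0]
  | succ n => exact hlow n (by omega) (hn.pred hre him)

/-- A Pearson equation of minimal degree divides all others. -/
theorem IsPearson.exists_eq_shift_mul (hα : ∀ n, (coeffSeq a n).1 ≠ 0)
    (hγ : ∀ n, (coeffSeq a (n + 1)).2 ≠ 0) (hu : IsMonicOPS u P) {d : ℕ}
    {κ₀ : StepAlgebra a c₃ c} (hκ₀ : IsPearson u κ₀) (h0 : κ₀ ≠ 0) (hd : InRange d κ₀)
    (hmin : ∀ κ : StepAlgebra a c₃ c, IsPearson u κ → ∀ m, m < d → InRange m κ → κ = 0)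
    {n : ℕ} {κ : StepAlgebra a c₃ c} (hκ : IsPearson u κ) (hn : InRange n κ) :
    ∃ g : ℂ[X], κ = shift a c₃ c g * κ₀ ∧ ∀ i, n < i + d → g.coeff i = 0 := by
  induction n using Nat.strong_induction_on generalizing κ with
  | _ n ih =>
    rcases lt_or_ge n d with hnd | hnd
    · exact ⟨0, by simpa using hmin κ hκ n hnd hn, by simp⟩
    obtain ⟨m, rfl⟩ := Nat.exists_eq_add_of_le hnd
    set η := shift a c₃ c (X ^ m) * κ₀ with hη
    have hηP : IsPearson u η := hκ₀.shift_mul _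
    have hηn : InRange (d + m) η := hd.shift_X_pow_mul m
    have hdet : leadDet (d + m) κ η = 0 := hκ.leadDet_eq_zero hα hu hηP hn hηn
    have hlead : ¬ (η.re.coeff (d + m + 1) = 0 ∧ η.im.coeff (d + m) = 0) := by
      rintro ⟨h1, h2⟩
      refine h0 (hκ₀.eq_zero_of_lead_eq_zero hγ hu hd ?_ ?_ (hmin κ₀ hκ₀))
      · have := leadDet_shift_X_pow hd (η := ⟨0, X ^ d⟩) ⟨by simp, by simp⟩ m
        rw [← hη, leadDet, leadDet, h1, h2] at this
        simpa using this.symm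
      · have := leadDet_shift_X_pow hd (η := ⟨X ^ (d + 1), 0⟩) ⟨by simp, by simp⟩ m
        rw [← hη, leadDet, leadDet, h1, h2] at this
        simpa using this.symm
    obtain ⟨t, ht1, ht2⟩ : ∃ t : ℂ, κ.re.coeff (d + m + 1) = t * η.re.coeff (d + m + 1) ∧
        κ.im.coeff (d + m) = t * η.im.coeff (d + m) := by
      rw [leadDet, sub_eq_zero] at hdet
      by_cases h1 : η.re.coeff (d + m + 1) = 0
      · have h2 : η.im.coeff (d + m) ≠ 0 := fun h2 => hlead ⟨h1, h2⟩
        refine ⟨κ.im.coeff (d + m) / η.im.coeff (d + m), ?_, by field_simp⟩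
        field_simp
        exact hdet
      · refine ⟨κ.re.coeff (d + m + 1) / η.re.coeff (d + m + 1), by field_simp, ?_⟩
        field_simp
        exact hdet.symm
    have hP := hκ.add (hηP.smul (-t))
    have hR : InRange (d + m) (κ + (-t) • η) := hn.add (hηn.smul _)
    have e1 : (κ + (-t) • η).re.coeff (d + m + 1) = 0 := by simp [ht1]
    have e2 : (κ + (-t) • η).im.coeff (d + m) = 0 := by simp [ht2]
    obtain ⟨g, hg, hgc⟩ : ∃ g : ℂ[X], κ + (-t) • η = shift a c₃ c g * κ₀ ∧
        ∀ i, d + m < i + d → g.coeff i = 0 := by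
      by_cases hz : κ + (-t) • η = 0
      · exact ⟨0, by simpa using hz, by simp⟩
      have : ¬ ∀ l, l < d + m → InRange l (κ + (-t) • η) → κ + (-t) • η = 0 := fun h =>
        hz (hP.eq_zero_of_lead_eq_zero hγ hu hR e1 e2 h)
      push Not at this
      obtain ⟨l, hl, hl', -⟩ := this
      obtain ⟨g, hg, hgc⟩ := ih l hl hP hl'
      exact ⟨g, hg, fun i hi => hgc i (by omega)⟩
    refine ⟨g + C t * X ^ m, ?_, fun i hi => ?_⟩
    · rw [map_add, map_mul, add_mul, ← hg, mul_assoc, shift_C_mul, ← hη]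
      simp
    · rw [coeff_add, hgc i hi, coeff_C_mul_X_pow, if_neg (by omega), zero_add]

/-- The operator `D^k` intertwines multiplication by `(X - c₃)` with multiplication by this
element. -/
noncomputable def twist (a c₃ c : ℂ) (k : ℕ) : StepAlgebra a c₃ c :=
  ⟨C (coeffSeq a k).1 * (X - C c₃), -C (coeffSeq a k).2⟩

theorem isPearson_of_transfer {k : ℕ} {r A B : ℂ[X]}
    (hA : ∀ f, v (r * (ddiff a c₃ c)^[k] f) = u (A * f))
    (hB : ∀ f, v (r * (X - C c₃) * (ddiff a c₃ c)^[k] f) = u (B * f)) :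
    IsPearson u (twist a c₃ c k * algebraMap ℂ[X] _ A - algebraMap ℂ[X] _ B) := fun f => by
  have h : ((twist a c₃ c k * algebraMap ℂ[X] _ A - algebraMap ℂ[X] _ B) * shift a c₃ c f).im =
      C (coeffSeq a k).1 * (A * ((X - C c₃) * ddiff a c₃ c f)) +
      C (-(coeffSeq a k).2) * (A * avg a c₃ c f) + C (-1) * (B * ddiff a c₃ c f) := by
    simp [twist, QuadraticAlgebra.algebraMap_re, QuadraticAlgebra.algebraMap_im]
    ring
  rw [h, map_add, map_add, map_C_mul, map_C_mul, map_C_mul, ← hA, ← hA, ← hB, ← map_C_mul,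
    ← map_C_mul, ← map_C_mul, ← map_add, ← map_add]
  have h2 := iterate_centered_mul_ddiff a c₃ c k f
  convert map_zero v using 2
  simp only [map_neg, map_one]
  linear_combination r * h2

theorem inRange_twist_mul_sub {k n : ℕ} {A B : ℂ[X]} (hA : A.natDegree ≤ n)
    (hB : B.natDegree ≤ n + 1) :
    InRange n (twist a c₃ c k * algebraMap ℂ[X] _ A - algebraMap ℂ[X] _ B) := by
  constructor
  · simp only [twist, QuadraticAlgebra.re_sub, QuadraticAlgebra.re_mul,
      QuadraticAlgebra.algebraMap_re, QuadraticAlgebra.algebraMap_im, mul_zero, add_zero]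
    refine (natDegree_sub_le_of_le (m := n + 1) ?_ hB).trans (max_self _).le
    refine natDegree_mul_le.trans ?_
    have : (C (coeffSeq a k).1 * (X - C c₃)).natDegree ≤ 1 := by compute_degree
    omega
  · simp only [twist, QuadraticAlgebra.im_sub, QuadraticAlgebra.im_mul,
      QuadraticAlgebra.algebraMap_re, QuadraticAlgebra.algebraMap_im, mul_zero, add_zero, zero_add,
      sub_zero]
    refine natDegree_mul_le.trans ?_
    simpa using hA

theorem exists_apply_eq_coeff_mul (hγ : ∀ n, (coeffSeq a (n + 1)).2 ≠ 0) {k : ℕ} {r A : ℂ[X]}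
    (hA : ∀ f, v (r * (ddiff a c₃ c)^[k] f) = u (A * f)) :
    ∃ t : ℂ, ∀ f : ℂ[X], f.natDegree ≤ k → u (A * f) = f.coeff k * t := by
  obtain ⟨l, -, h⟩ := exists_coeff_iterate_ddiff (c₃ := c₃) (c := c) hγ k 0
  refine ⟨l * v r, fun f hf => ?_⟩
  obtain ⟨h1, h2⟩ := h f (by omega)
  rw [← hA, eq_C_of_natDegree_le_zero h1, h2, mul_comm, map_C_mul]
  ring_nf

/-- A polynomial orthogonal to all polynomials of degree less than `k` is a combination of any
such polynomials of degrees `k`, `k + 1` and `k + 2`. -/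
theorem exists_eq_combination (hu : IsMonicOPS u P) {k : ℕ} (hk : 1 ≤ k) {R A B D : ℂ[X]}
    (hR : R.natDegree ≤ k + 2) (hA : A.natDegree ≤ k) (hB : B.natDegree ≤ k + 1)
    (hD : D.natDegree ≤ k + 2) (hA0 : A.coeff k ≠ 0) (hB0 : B.coeff (k + 1) ≠ 0)
    (hD0 : D.coeff (k + 2) ≠ 0)
    (horth : ∀ f : ℂ[X], f.natDegree < k →
      u (R * f) = 0 ∧ u (A * f) = 0 ∧ u (B * f) = 0 ∧ u (D * f) = 0) :
    ∃ e₂ e₁ e₀ : ℂ, R = C e₂ * D + C e₁ * B + C e₀ * A ∧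
      R.coeff (k + 2) = e₂ * D.coeff (k + 2) := by
  have reduce : ∀ {n : ℕ} {F G : ℂ[X]}, F.natDegree ≤ n + 1 → G.natDegree ≤ n + 1 →
      G.coeff (n + 1) ≠ 0 → ∃ e, (F - C e * G).natDegree ≤ n ∧
        F.coeff (n + 1) = e * G.coeff (n + 1) := by
    intro n F G hF hG hG0
    refine ⟨F.coeff (n + 1) / G.coeff (n + 1), natDegree_le_of_coeff_succ
      ((natDegree_sub_le_of_le hF ((natDegree_C_mul_le _ _).trans hG)).trans (max_self _).le) ?_, ?_⟩
    · rw [coeff_sub, coeff_C_mul, div_mul_cancel₀ _ hG0, sub_self]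
    · rw [div_mul_cancel₀ _ hG0]
  obtain ⟨l, rfl⟩ := Nat.exists_eq_add_of_le' hk
  obtain ⟨e₂, h2, h2'⟩ := reduce hR hD hD0
  obtain ⟨e₁, h1, -⟩ := reduce h2 hB hB0
  obtain ⟨e₀, h0, -⟩ := reduce h1 hA hA0
  refine ⟨e₂, e₁, e₀, ?_, h2'⟩
  have : R - C e₂ * D - C e₁ * B - C e₀ * A = 0 := hu.eq_zero_of_apply fun g hg => by
    obtain ⟨h1, h2, h3, h4⟩ := horth g (by omega)
    rw [sub_mul, sub_mul, sub_mul, map_sub, map_sub, map_sub, mul_assoc, mul_assoc, mul_assoc,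
      map_C_mul, map_C_mul, map_C_mul, h1, h2, h3, h4]
    simp
  linear_combination this

theorem isCoprime_of_apply {k : ℕ} {A B : ℂ[X]} (hA : A.natDegree = k)
    (hA0 : A ≠ 0) (hB : B.natDegree ≤ k + 1) (hB0 : B.coeff (k + 1) ≠ 0) {s t : ℂ} (hs : s ≠ 0)
    (hAs : ∀ f : ℂ[X], f.natDegree ≤ k → u (A * f) = f.coeff k * s)
    (hBt : ∀ f : ℂ[X], f.natDegree ≤ k → u (B * f) = f.coeff k * t) : IsCoprime A B := by
  rw [isCoprime_iff_aeval_ne_zero_of_isAlgClosed ℂ ℂ]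
  by_contra! h
  obtain ⟨w, hAw, hBw⟩ := h
  rw [coe_aeval_eq_eval] at hAw hBw
  obtain ⟨g, rfl⟩ := dvd_iff_isRoot.mpr hAw
  obtain ⟨h, rfl⟩ := dvd_iff_isRoot.mpr hBw
  have hg0 : g ≠ 0 := right_ne_zero_of_mul hA0
  have hh0 : h ≠ 0 := fun h0 => by simp [h0] at hB0
  rw [natDegree_mul (X_sub_C_ne_zero w) hg0, natDegree_X_sub_C] at hA
  rw [natDegree_mul (X_sub_C_ne_zero w) hh0, natDegree_X_sub_C] at hB
  have h1 : (X - C w) * h * g = (X - C w) * g * h := by ring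
  have h2 := hBt g (by omega)
  rw [coeff_eq_zero_of_natDegree_lt (by omega), zero_mul, h1, hAs h (by omega)] at h2
  refine (mul_eq_zero.mp h2).elim (fun h3 => hB0 ?_) hs
  rw [sub_mul, coeff_sub, coeff_X_mul, coeff_C_mul, h3,
    coeff_eq_zero_of_natDegree_lt (by omega), mul_zero, sub_zero]

theorem natDegree_mul_shift_le {g : ℂ[X]} {m : ℕ} (hg : g.natDegree ≤ m)
    {τ : StepAlgebra a c₃ c} (hre : τ.re.natDegree ≤ 1) (him : τ.im.natDegree ≤ 0) :
    (τ * shift a c₃ c g).re.natDegree ≤ m + 1 ∧ (τ * shift a c₃ c g).im.natDegree ≤ m + 1 := by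
  obtain ⟨h1, h2, h3⟩ : (avg a c₃ c g).natDegree ≤ m ∧ (ddiff a c₃ c g).natDegree ≤ m ∧
      (stepSq a c₃ c * ddiff a c₃ c g).natDegree ≤ m + 1 := by
    cases m with
    | zero =>
      rw [eq_C_of_natDegree_le_zero hg]
      simp
    | succ m =>
      obtain ⟨⟨h1, h2⟩, -⟩ := inRange_shift (a := a) (c₃ := c₃) (c := c) hg
      refine ⟨h1, h2.trans (by omega), natDegree_mul_le.trans ?_⟩
      have := natDegree_stepSq_le a c₃ c
      rw [im_shift] at h2
      omega
  constructor
  · have e : (τ * shift a c₃ c g).re = τ.re * avg a c₃ c g +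
        τ.im * (stepSq a c₃ c * ddiff a c₃ c g) := by simp; ring
    rw [e]
    exact natDegree_add_le_of_degree_le (natDegree_mul_le.trans (by omega))
      (natDegree_mul_le.trans (by omega))
  · rw [im_mul_shift]
    exact natDegree_add_le_of_degree_le (natDegree_mul_le.trans (by omega))
      (natDegree_mul_le.trans (by omega))

/-- The element acting on `κ` in a dependence between the first two moments of `D^k`. -/
noncomputable def linearTwist (a c₃ c : ℂ) (k : ℕ) (e₂ e₁ : ℂ) : StepAlgebra a c₃ c :=
  algebraMap ℂ[X] _ (C e₂) * twist a c₃ c k - algebraMap ℂ[X] _ (X - C c₃) +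
    algebraMap ℂ[X] _ (C e₁)

theorem natDegree_linearTwist (k : ℕ) (e₂ e₁ : ℂ) :
    (linearTwist a c₃ c k e₂ e₁).re.natDegree ≤ 1 ∧
    (linearTwist a c₃ c k e₂ e₁).im.natDegree ≤ 0 := by
  simp only [linearTwist, twist, QuadraticAlgebra.re_add, QuadraticAlgebra.re_sub,
    QuadraticAlgebra.re_mul, QuadraticAlgebra.algebraMap_re, QuadraticAlgebra.algebraMap_im,
    QuadraticAlgebra.im_add, QuadraticAlgebra.im_sub, QuadraticAlgebra.im_mul]
  constructor
  · simp only [mul_zero, zero_mul, add_zero]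
    compute_degree
  · simp only [mul_zero, zero_mul, add_zero, sub_zero]
    compute_degree

theorem linearTwist_mul_twist_ne_zero {k : ℕ} (hγ : (coeffSeq a k).2 ≠ 0) {e₂ : ℂ} (he : e₂ ≠ 0)
    (e₁ : ℂ) {p : ℂ[X]} (hp : p.natDegree ≤ 1) :
    linearTwist a c₃ c k e₂ e₁ * twist a c₃ c k + algebraMap ℂ[X] _ p ≠ 0 := by
  intro h
  obtain ⟨b, e₀, rfl⟩ := exists_eq_X_add_C_of_natDegree_le_one hp
  have him := fun z => congrArg (fun κ : StepAlgebra a c₃ c => κ.im.eval z) h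
  have hre := fun z => congrArg (fun κ : StepAlgebra a c₃ c => κ.re.eval z) h
  have hs := coeffSeq_sq a k
  simp only [linearTwist, twist, QuadraticAlgebra.re_add, QuadraticAlgebra.re_sub,
    QuadraticAlgebra.re_mul, QuadraticAlgebra.algebraMap_re, QuadraticAlgebra.algebraMap_im,
    QuadraticAlgebra.im_add, QuadraticAlgebra.im_sub, QuadraticAlgebra.im_mul] at him hre
  simp [stepSq] at him hre
  have h1 : (coeffSeq a k).2 * (2 * e₂ * (coeffSeq a k).1 - 1) = 0 := by
    linear_combination him c₃ - him (c₃ + 1)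
  have h2 := (mul_eq_zero.mp h1).resolve_left hγ
  refine he ?_
  linear_combination (hre c₃) - (hre (c₃ + 1) + hre (c₃ - 1)) / 2 - e₂ * hs +
    (coeffSeq a k).1 * h2

theorem exists_isPearson_inRange_one (hα : ∀ n, (coeffSeq a n).1 ≠ 0)
    (hγ : ∀ n, (coeffSeq a (n + 1)).2 ≠ 0) (hu : IsMonicOPS u P) {k : ℕ} (hk : 1 ≤ k)
    (hbasis : ∀ n, ∃ t : ℂ, t ≠ 0 ∧
      ∀ f, v ((ddiff a c₃ c)^[k] (P (n + k)) * (ddiff a c₃ c)^[k] f) = u (C t * P (n + k) * f)) :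
    ∃ κ : StepAlgebra a c₃ c, IsPearson u κ ∧ κ ≠ 0 ∧ InRange 1 κ := by
  have hγk : (coeffSeq a k).2 ≠ 0 := by
    obtain ⟨l, rfl⟩ := Nat.exists_eq_add_of_le' hk
    exact hγ l
  have hXk : ∀ n, ((X - C c₃) ^ n).natDegree = n ∧ ((X - C c₃) ^ n).coeff n ≠ 0 := fun n => by
    have h1 : ((X - C c₃) ^ n).natDegree = n := by simp
    have h2 := ((monic_X_sub_C c₃).pow n).coeff_natDegree
    rw [h1] at h2
    exact ⟨h1, by simp [h2]⟩
  obtain ⟨A, hA, hA0, hAv⟩ := exists_transfer hγ hu hbasis 0 (hXk 0).1.le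
  obtain ⟨B, hB, hB0, hBv⟩ := exists_transfer hγ hu hbasis 1 (hXk 1).1.le
  obtain ⟨D, hD, hD0, hDv⟩ := exists_transfer hγ hu hbasis 2 (hXk 2).1.le
  replace hA0 := hA0 (hXk 0).2
  replace hB0 := hB0 (hXk 1).2
  replace hD0 := hD0 (hXk 2).2
  rw [zero_add] at hA hA0
  rw [add_comm] at hB hB0 hD hD0
  have hAd : A.natDegree = k := natDegree_eq_of_le_of_coeff_ne_zero hA hA0
  have hAne : A ≠ 0 := fun h => by simp [h] at hA0
  rw [pow_zero] at hAv
  rw [pow_one] at hBv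
  rw [pow_two] at hDv
  -- the two Pearson equations
  have hκ : IsPearson u (twist a c₃ c k * algebraMap ℂ[X] _ A - algebraMap ℂ[X] _ B) :=
    isPearson_of_transfer hAv (by simpa using hBv)
  have hη : IsPearson u (twist a c₃ c k * algebraMap ℂ[X] _ B - algebraMap ℂ[X] _ D) :=
    isPearson_of_transfer hBv hDv
  have hκn := inRange_twist_mul_sub (a := a) (c₃ := c₃) (c := c) (k := k) hA hB
  have hηn := inRange_twist_mul_sub (a := a) (c₃ := c₃) (c := c) (k := k) hB hD
  set κ : StepAlgebra a c₃ c := twist a c₃ c k * algebraMap ℂ[X] _ A - algebraMap ℂ[X] _ B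
    with hκdef
  set η : StepAlgebra a c₃ c := twist a c₃ c k * algebraMap ℂ[X] _ B - algebraMap ℂ[X] _ D
    with hηdef
  have hκ0 : κ ≠ 0 := fun h => by
    have h1 := congrArg QuadraticAlgebra.im h
    simp only [hκdef, twist, QuadraticAlgebra.im_sub, QuadraticAlgebra.im_mul,
      QuadraticAlgebra.algebraMap_re, QuadraticAlgebra.algebraMap_im, QuadraticAlgebra.im_zero]
      at h1
    simp [hγk, hAne] at h1
  -- the Pearson equation of minimal degree
  classical
  have hex : ∃ d, ∃ κ : StepAlgebra a c₃ c, IsPearson u κ ∧ κ ≠ 0 ∧ InRange d κ :=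
    ⟨k, κ, hκ, hκ0, hκn⟩
  obtain ⟨κ₀, hκ₀, hκ₀0, hκ₀d⟩ := Nat.find_spec hex
  set d := Nat.find hex with hd
  have hmin : ∀ ζ : StepAlgebra a c₃ c, IsPearson u ζ → ∀ m, m < d → InRange m ζ → ζ = 0 :=
    fun ζ hζ m hm hζm => by
      by_contra h0
      exact Nat.find_min hex hm ⟨ζ, hζ, h0, hζm⟩
  rcases lt_or_ge 1 d with hd1 | hd1
  swap
  · exact ⟨κ₀, hκ₀, hκ₀0, hκ₀d.of_le hd1⟩
  exfalso
  have hdk : d ≤ k := Nat.find_le ⟨κ, hκ, hκ0, hκn⟩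
  obtain ⟨g, hg, hgd⟩ := hκ₀.exists_eq_shift_mul hα hγ hu hκ₀0 hκ₀d hmin hκ hκn
  obtain ⟨h, hh, hhd⟩ := hκ₀.exists_eq_shift_mul hα hγ hu hκ₀0 hκ₀d hmin hη hηn
  replace hgd : g.natDegree ≤ k - d := natDegree_le_iff_coeff_eq_zero.mpr fun i hi =>
    hgd i (by omega)
  replace hhd : h.natDegree ≤ k + 1 - d := natDegree_le_iff_coeff_eq_zero.mpr fun i hi =>
    hhd i (by omega)
  -- the first moments on polynomials of degree at most `k`
  obtain ⟨s, hs⟩ := exists_apply_eq_coeff_mul hγ hAv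
  obtain ⟨t, ht⟩ := exists_apply_eq_coeff_mul hγ hBv
  have hs0 : s ≠ 0 := fun h0 => hAne (hu.eq_zero_of_apply fun f hf => by
    rw [hs f (hAd ▸ hf), h0, mul_zero])
  obtain ⟨m, n, hmn⟩ := isCoprime_of_apply hAd hAne hB hB0 hs0 hs ht
  -- a linear dependence
  set b := t / s with hb
  have hRlow : ∀ f : ℂ[X], f.natDegree < k → u ((X - C c₃) * (B - C b * A) * f) = 0 := by
    intro f hf
    have hf' : ((X - C c₃) * f).natDegree ≤ k :=
      natDegree_mul_le.trans (by rw [natDegree_X_sub_C]; omega)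
    have e : (X - C c₃) * (B - C b * A) * f =
        B * ((X - C c₃) * f) - C b * (A * ((X - C c₃) * f)) := by ring
    rw [e, map_sub, map_C_mul, hs _ hf', ht _ hf', hb]
    field_simp
    ring
  have hlow : ∀ {r G : ℂ[X]}, (∀ f, v (r * (ddiff a c₃ c)^[k] f) = u (G * f)) →
      ∀ f : ℂ[X], f.natDegree < k → u (G * f) = 0 := fun hG f hf => by
    rw [← hG, iterate_ddiff_eq_zero hγ hf, mul_zero, map_zero]
  have hBA : (B - C b * A).natDegree ≤ k + 1 :=
    (natDegree_sub_le_of_le hB ((natDegree_C_mul_le _ _).trans (by omega))).trans (max_self _).le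
  obtain ⟨e₂, e₁, e₀, hR, hlead⟩ := exists_eq_combination hu hk
    (R := (X - C c₃) * (B - C b * A)) (natDegree_mul_le.trans (by rw [natDegree_X_sub_C]; omega))
    hA hB hD hA0 hB0 hD0 fun f hf => ⟨hRlow f hf, hlow hAv f hf, hlow hBv f hf, hlow hDv f hf⟩
  have he₂ : e₂ ≠ 0 := fun h0 => hB0 (by
    rw [h0, zero_mul, sub_mul, coeff_sub, coeff_X_mul, coeff_C_mul,
      coeff_eq_zero_of_natDegree_lt (n := k + 2) (by omega), mul_zero, sub_zero, coeff_sub,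
      coeff_C_mul, coeff_eq_zero_of_natDegree_lt (p := A) (by omega), mul_zero, sub_zero] at hlead
    exact hlead)
  have hp : (C b * (X - C c₃) + C e₀).natDegree ≤ 1 := by compute_degree
  have hθ := linearTwist_mul_twist_ne_zero (c₃ := c₃) (c := c) hγk he₂ e₁ hp
  set p : ℂ[X] := C b * (X - C c₃) + C e₀ with hpdef
  set ξ := twist a c₃ c k with hξ
  set lam := linearTwist a c₃ c k e₂ e₁ with hlam
  set θ := lam * ξ + algebraMap ℂ[X] _ p with hθdef
  set ν := algebraMap ℂ[X] (StepAlgebra a c₃ c) (C e₂) * shift a c₃ c h + lam * shift a c₃ c g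
    with hν
  have hθA : θ * algebraMap ℂ[X] _ A = ν * κ₀ := by
    have hR' := congrArg (algebraMap ℂ[X] (StepAlgebra a c₃ c)) hR
    have hl : lam = algebraMap ℂ[X] _ (C e₂) * ξ - algebraMap ℂ[X] _ (X - C c₃) +
      algebraMap ℂ[X] _ (C e₁) := rfl
    have e : ν * κ₀ = algebraMap ℂ[X] (StepAlgebra a c₃ c) (C e₂) * η + lam * κ := by
      rw [hh, hg, hν]; ring
    rw [e, hθdef, hκdef, hηdef, hl, hpdef]
    simp only [map_mul, map_add, map_sub] at hR' ⊢
    linear_combination -hR'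
  have hνA : algebraMap ℂ[X] _ A * (algebraMap ℂ[X] _ m * ν +
      algebraMap ℂ[X] _ n * (ξ * ν - θ * shift a c₃ c g)) = ν := by
    have hmn' := congrArg (algebraMap ℂ[X] (StepAlgebra a c₃ c)) hmn
    simp only [map_mul, map_add, map_one] at hmn'
    rw [hg] at hκdef
    linear_combination ν * hmn' - algebraMap ℂ[X] _ n * shift a c₃ c g * hθA -
      algebraMap ℂ[X] _ n * ν * hκdef
  have hνd : ν.re.natDegree < k ∧ ν.im.natDegree < k := by
    obtain ⟨h1, h2⟩ := natDegree_mul_shift_le hgd (natDegree_linearTwist (a := a) (c := c) k e₂ e₁).1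
      (natDegree_linearTwist (c₃ := c₃) k e₂ e₁).2
    have h3 : (avg a c₃ c h).natDegree ≤ k + 1 - d ∧ (ddiff a c₃ c h).natDegree ≤ k + 1 - d := by
      obtain ⟨l, hl⟩ : ∃ l, k + 1 - d = l + 1 := ⟨k - d, by omega⟩
      rw [hl] at hhd ⊢
      obtain ⟨⟨h3, h4⟩, -⟩ := inRange_shift (a := a) (c₃ := c₃) (c := c) hhd
      exact ⟨h3, h4.trans (by omega)⟩
    simp only [hν, QuadraticAlgebra.re_add, QuadraticAlgebra.im_add, ← Algebra.smul_def,
      QuadraticAlgebra.re_smul, QuadraticAlgebra.im_smul, smul_eq_mul, re_shift, im_shift]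
    constructor
    · refine (natDegree_add_le_of_degree_le (n := k + 1 - d)
        ((natDegree_C_mul_le _ _).trans h3.1) (h1.trans (by omega))).trans_lt (by omega)
    · refine (natDegree_add_le_of_degree_le (n := k + 1 - d)
        ((natDegree_C_mul_le _ _).trans h3.2) (h2.trans (by omega))).trans_lt (by omega)
  rw [← Algebra.smul_def] at hνA
  have hν0 : ν = 0 := QuadraticAlgebra.ext
    (eq_zero_of_dvd_of_natDegree_lt (Dvd.intro _ (congrArg QuadraticAlgebra.re hνA))
      (hAd ▸ hνd.1))
    (eq_zero_of_dvd_of_natDegree_lt (Dvd.intro _ (congrArg QuadraticAlgebra.im hνA))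
      (hAd ▸ hνd.2))
  rw [hν0, zero_mul, mul_comm, ← Algebra.smul_def] at hθA
  exact hθ (QuadraticAlgebra.ext
    ((mul_eq_zero.mp (congrArg QuadraticAlgebra.re hθA)).resolve_left hAne)
    ((mul_eq_zero.mp (congrArg QuadraticAlgebra.im hθA)).resolve_left hAne))

/-- Evaluating the shift: if `w` is a half-step at `z`, then `f` at the shifted point is
`(S f)(z) + w (D f)(z)`. -/
theorem eval_shifted {z w : ℂ} (hw : w ^ 2 = (stepSq a c₃ c).eval z) (f : ℂ[X]) :
    f.eval (a * (z - c₃) + c₃ + w) = (avg a c₃ c f).eval z + w * (ddiff a c₃ c f).eval z := by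
  induction f using centered_induction c₃ with
  | hone =>
    have h1 := avg_C a c₃ c 1
    have h2 := ddiff_C a c₃ c 1
    rw [C_1] at h1 h2
    simp [h1, h2]
  | hadd f g hf hg => simp only [map_add, eval_add, hf, hg]; ring
  | hC r f hf => simp only [avg_C_mul, ddiff_C_mul, eval_mul, eval_C, hf]; ring
  | hmul f hf =>
    simp only [avg_centered_mul, ddiff_centered_mul, eval_mul, eval_add, eval_sub, eval_X, eval_C,
      hf, ← hw]
    ring

theorem exists_coeffSeq_ofReal {r : ℝ} (hr : 1 < r) (n : ℕ) : ∃ x y : ℝ, 1 ≤ x ∧ 0 ≤ y ∧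
    (coeffSeq (r : ℂ) n).1 = x ∧ (coeffSeq (r : ℂ) n).2 = y := by
  induction n with
  | zero => exact ⟨1, 0, le_rfl, le_rfl, by simp [coeffSeq], by simp [coeffSeq]⟩
  | succ n ih =>
    obtain ⟨x, y, hx, hy, h1, h2⟩ := ih
    have hr2 : 0 ≤ (r ^ 2 - 1) * y := mul_nonneg (by nlinarith) hy
    refine ⟨r * x + (r ^ 2 - 1) * y, x + r * y, by nlinarith, by positivity, ?_, ?_⟩ <;>
      simp [coeffSeq, h1, h2]

theorem coeffSeq_fst_ne_zero {r : ℝ} (hr : 1 < r) (n : ℕ) : (coeffSeq (r : ℂ) n).1 ≠ 0 := by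
  obtain ⟨x, y, hx, -, h1, -⟩ := exists_coeffSeq_ofReal hr n
  rw [h1]
  exact_mod_cast (by positivity : x ≠ 0)

theorem coeffSeq_succ_snd_ne_zero {r : ℝ} (hr : 1 < r) (n : ℕ) :
    (coeffSeq (r : ℂ) (n + 1)).2 ≠ 0 := by
  obtain ⟨x, y, hx, hy, h1, h2⟩ := exists_coeffSeq_ofReal hr n
  have h : x + r * y ≠ 0 := by positivity
  simp only [coeffSeq_succ, h1, h2]
  exact_mod_cast h

section Lattice

variable {q : ℝ} {c1 c2 c3 : ℂ}

theorem qp_add (q : ℝ) (s t : ℂ) : qp q (s + t) = qp q s * qp q t := by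
  rw [qp, qp, qp, add_mul, Complex.exp_add]

theorem qp_neg (q : ℝ) (t : ℂ) : qp q (-t) = (qp q t)⁻¹ := by
  rw [qp, qp, neg_mul, Complex.exp_neg]

theorem qp_ne_zero (q : ℝ) (t : ℂ) : qp q t ≠ 0 := Complex.exp_ne_zero _

theorem alphaL_eq_cosh (q : ℝ) : alphaL q = (Real.cosh (Real.log q / 2) : ℝ) := by
  rw [Complex.ofReal_cosh, Complex.cosh, alphaL, qp, qp]
  push_cast
  ring_nf

theorem alphaL_eq (q : ℝ) : alphaL q = (qp q (1 / 2) + (qp q (1 / 2))⁻¹) / 2 := by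
  rw [alphaL, qp_neg]

theorem latX_eq (q : ℝ) (c1 c2 c3 s : ℂ) :
    latX q c1 c2 c3 s = c1 * (qp q s)⁻¹ + c2 * qp q s + c3 := by
  rw [latX, qp_neg]

theorem latX_surjective (hq : 0 < q) (hq1 : q ≠ 1) (hc : c1 * c2 ≠ 0) :
    Function.Surjective (latX q c1 c2 c3) := by
  intro x
  have hlog : (Real.log q : ℂ) ≠ 0 := by
    exact_mod_cast Real.log_ne_zero_of_pos_of_ne_one hq hq1
  have hc2 : c2 ≠ 0 := right_ne_zero_of_mul hc
  obtain ⟨d, hd⟩ := IsAlgClosed.exists_pow_nat_eq ((x - c3) ^ 2 - 4 * (c1 * c2)) zero_lt_two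
  have hz : x - c3 + d ≠ 0 := fun h => hc (by linear_combination (x - c3 - d) / 4 * h + hd / 4)
  set z := (x - c3 + d) / (2 * c2) with hzdef
  have hz0 : z ≠ 0 := div_ne_zero hz (mul_ne_zero two_ne_zero hc2)
  refine ⟨Complex.log z / Real.log q, ?_⟩
  have hqp : qp q (Complex.log z / Real.log q) = z := by
    rw [qp, div_mul_cancel₀ _ hlog, Complex.exp_log hz0]
  rw [latX_eq, hqp]
  have h2 : 2 * c2 * z = x - c3 + d := by rw [hzdef]; field_simp
  have h3 : c2 * z ^ 2 - (x - c3) * z + c1 = 0 := by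
    refine (mul_eq_zero.mp (?_ : (4 * c2) * _ = 0)).resolve_left (by simpa using hc2)
    linear_combination (2 * c2 * z - (x - c3) + d) * h2 + hd
  field_simp
  linear_combination h3

theorem halfStep_sq (q : ℝ) (c1 c2 c3 s : ℂ) :
    ((latX q c1 c2 c3 (s + 1 / 2) - latX q c1 c2 c3 (s - 1 / 2)) / 2) ^ 2 =
      (stepSq (alphaL q) c3 (4 * (c1 * c2))).eval (latX q c1 c2 c3 s) := by
  have h1 := qp_ne_zero q s
  have h2 := qp_ne_zero q (1 / 2)
  simp only [latX_eq, sub_eq_add_neg s, qp_add, qp_neg, alphaL_eq, stepSq, eval_mul, eval_sub,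
    eval_pow, eval_X, eval_C]
  field_simp
  ring

theorem latX_mean (q : ℝ) (c1 c2 c3 s : ℂ) :
    alphaL q * (latX q c1 c2 c3 s - c3) + c3 =
      (latX q c1 c2 c3 (s + 1 / 2) + latX q c1 c2 c3 (s - 1 / 2)) / 2 := by
  have h1 := qp_ne_zero q s
  have h2 := qp_ne_zero q (1 / 2)
  simp only [latX_eq, sub_eq_add_neg s, qp_add, qp_neg, alphaL_eq]
  field_simp
  ring

theorem eval_latX_add_sub (q : ℝ) (c1 c2 c3 s : ℂ) (f : ℂ[X]) :
    f.eval (latX q c1 c2 c3 (s + 1 / 2)) =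
      (avg (alphaL q) c3 (4 * (c1 * c2)) f).eval (latX q c1 c2 c3 s) +
      (latX q c1 c2 c3 (s + 1 / 2) - latX q c1 c2 c3 (s - 1 / 2)) / 2 *
        (ddiff (alphaL q) c3 (4 * (c1 * c2)) f).eval (latX q c1 c2 c3 s) ∧
    f.eval (latX q c1 c2 c3 (s - 1 / 2)) =
      (avg (alphaL q) c3 (4 * (c1 * c2)) f).eval (latX q c1 c2 c3 s) -
      (latX q c1 c2 c3 (s + 1 / 2) - latX q c1 c2 c3 (s - 1 / 2)) / 2 *
        (ddiff (alphaL q) c3 (4 * (c1 * c2)) f).eval (latX q c1 c2 c3 s) := by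
  have h := halfStep_sq q c1 c2 c3 s
  constructor
  · rw [← eval_shifted h, latX_mean]
    ring_nf
  · have h' := eval_shifted ((neg_sq _).trans h) f
    rw [latX_mean, neg_mul, ← sub_eq_add_neg _ (_ * _)] at h'
    rw [← h']
    ring_nf

theorem eq_avg (hq : 0 < q) (hq1 : q ≠ 1) (hc : c1 * c2 ≠ 0) {f g : ℂ[X]}
    (hg : ∀ s : ℂ, g.eval (latX q c1 c2 c3 s) =
      (f.eval (latX q c1 c2 c3 (s + 1/2)) + f.eval (latX q c1 c2 c3 (s - 1/2))) / 2) :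
    g = avg (alphaL q) c3 (4 * (c1 * c2)) f := by
  refine Polynomial.funext fun x => ?_
  obtain ⟨s, rfl⟩ := latX_surjective (c3 := c3) hq hq1 hc x
  obtain ⟨h1, h2⟩ := eval_latX_add_sub q c1 c2 c3 s f
  rw [hg, h1, h2]
  ring

theorem one_lt_cosh_log (hq : 0 < q) (hq1 : q ≠ 1) : 1 < Real.cosh (Real.log q / 2) :=
  Real.one_lt_cosh.mpr (div_ne_zero (Real.log_ne_zero_of_pos_of_ne_one hq hq1) two_ne_zero)

theorem eq_ddiff (hq : 0 < q) (hq1 : q ≠ 1) (hc : c1 * c2 ≠ 0) {f g : ℂ[X]}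
    (hg : ∀ s : ℂ, latX q c1 c2 c3 (s + 1/2) ≠ latX q c1 c2 c3 (s - 1/2) →
      g.eval (latX q c1 c2 c3 s) =
        (f.eval (latX q c1 c2 c3 (s + 1/2)) - f.eval (latX q c1 c2 c3 (s - 1/2))) /
          (latX q c1 c2 c3 (s + 1/2) - latX q c1 c2 c3 (s - 1/2))) :
    g = ddiff (alphaL q) c3 (4 * (c1 * c2)) f := by
  have hstep : stepSq (alphaL q) c3 (4 * (c1 * c2)) ≠ 0 := fun h => by
    have h1 := coeff_stepSq_two (alphaL q) c3 (4 * (c1 * c2))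
    have h2 := one_lt_cosh_log hq hq1
    rw [h, coeff_zero, alphaL_eq_cosh] at h1
    have h3 : (0 : ℝ) = Real.cosh (Real.log q / 2) ^ 2 - 1 := by exact_mod_cast h1
    nlinarith
  refine sub_eq_zero.mp ((mul_eq_zero.mp (Polynomial.funext fun x => ?_)).resolve_right hstep)
  obtain ⟨s, rfl⟩ := latX_surjective (c3 := c3) hq hq1 hc x
  rw [eval_mul, ← halfStep_sq, eval_zero]
  by_cases hs : latX q c1 c2 c3 (s + 1 / 2) = latX q c1 c2 c3 (s - 1 / 2)
  · rw [hs, sub_self, zero_div, zero_pow two_ne_zero, mul_zero]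
  · obtain ⟨h1, h2⟩ := eval_latX_add_sub q c1 c2 c3 s f
    have hs' := sub_ne_zero.mpr hs
    rw [eval_sub, hg s hs, h1, h2]
    generalize latX q c1 c2 c3 (s + 1 / 2) - latX q c1 c2 c3 (s - 1 / 2) = δ at hs'
    field_simp
    ring

end Lattice

end QLattice

open QLattice

theorem stmt_10 (q : ℝ) (hq : 0 < q) (hq1 : q ≠ 1) (c1 c2 c3 : ℂ) (hc : c1 * c2 ≠ 0)
    (Dx Sx : Polynomial ℂ → Polynomial ℂ)
    (hDx : ∀ (f : Polynomial ℂ) (s : ℂ),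
      latX q c1 c2 c3 (s + 1/2) ≠ latX q c1 c2 c3 (s - 1/2) →
      (Dx f).eval (latX q c1 c2 c3 s) =
        (f.eval (latX q c1 c2 c3 (s + 1/2)) - f.eval (latX q c1 c2 c3 (s - 1/2))) /
          (latX q c1 c2 c3 (s + 1/2) - latX q c1 c2 c3 (s - 1/2)))
    (hSx : ∀ (f : Polynomial ℂ) (s : ℂ),
      (Sx f).eval (latX q c1 c2 c3 s) =
        (f.eval (latX q c1 c2 c3 (s + 1/2)) + f.eval (latX q c1 c2 c3 (s - 1/2))) / 2)
    (u : Polynomial ℂ →ₗ[ℂ] ℂ)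
    (P : ℕ → Polynomial ℂ)
    (hPm : ∀ n, (P n).Monic) (hPd : ∀ n, (P n).natDegree = n)
    (hPo : ∀ n m, n ≠ m → u (P n * P m) = 0)
    (hPn : ∀ n, u (P n * P n) ≠ 0)
    (k : ℕ) (hk : 1 ≤ k)
    (v : Polynomial ℂ →ₗ[ℂ] ℂ) (hvreg : IsRegularFunc v)
    (hvo : ∀ n m : ℕ, n ≠ m →
      v ((C (gammaFact q n / gammaFact q (n + k)) * Dx^[k] (P (n + k))) *
        (C (gammaFact q m / gammaFact q (m + k)) * Dx^[k] (P (m + k)))) = 0)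
    (hvn : ∀ n : ℕ,
      v ((C (gammaFact q n / gammaFact q (n + k)) * Dx^[k] (P (n + k))) ^ 2) ≠ 0) :
    ∃ φ ψ : Polynomial ℂ, φ ≠ 0 ∧ φ.degree ≤ 2 ∧ ψ ≠ 0 ∧ ψ.degree ≤ 1 ∧
      ∀ f : Polynomial ℂ, u (φ * Dx f) + u (ψ * Sx f) = 0 := by
  have hD : Dx = ddiff (alphaL q) c3 (4 * (c1 * c2)) :=
    _root_.funext fun f => eq_ddiff hq hq1 hc (hDx f)
  have hS : ∀ f, Sx f = avg (alphaL q) c3 (4 * (c1 * c2)) f := fun f =>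
    eq_avg hq hq1 hc (hSx f)
  subst hD
  have hcosh := one_lt_cosh_log hq hq1
  have hα : ∀ n, (coeffSeq (alphaL q) n).1 ≠ 0 := by
    rw [alphaL_eq_cosh]; exact coeffSeq_fst_ne_zero hcosh
  have hγ : ∀ n, (coeffSeq (alphaL q) (n + 1)).2 ≠ 0 := by
    rw [alphaL_eq_cosh]; exact coeffSeq_succ_snd_ne_zero hcosh
  have hu : IsMonicOPS u P := ⟨hPm, hPd, hPo, hPn⟩
  have hs : ∀ n, gammaFact q n / gammaFact q (n + k) ≠ 0 := fun n h => hvn n (by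
    rw [h]; simp)
  obtain ⟨κ, hκ, hκ0, hκ1⟩ := exists_isPearson_inRange_one hα hγ hu hk
    (exists_transfer_basis hγ hu hs hvo hvn)
  refine ⟨κ.re, κ.im, fun h => hκ0 (hκ.eq_zero_of_re hα hu h),
    degree_le_of_natDegree_le hκ1.1, fun h => hκ0 (hκ.eq_zero_of_im hγ hu h),
    degree_le_of_natDegree_le hκ1.2, fun f => ?_⟩
  rw [hS, ← map_add, ← im_mul_shift]
  exact hκ f
end

section
/- With the q-quadratic lattice, the operators D_x, S_x, and the Pearson data as in the context, let u be a nonzero ℂ-linear functional on complex polynomials satisfying u(φ·D_xf) + u(ψ·S_xf) = 0 for every polynomial f. Then u is regular if and only if for every n ≥ 0 both d_n ≠ 0 and φ^{[n]}( 𝔠₃ − e_n/d_{2n} ) ≠ 0. -/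
open Polynomial

noncomputable def dN (q : ℝ) (pa pd : ℂ) (n : ℕ) : ℂ := pa * gammaN q n + pd * alphaN q n

noncomputable def eN (q : ℝ) (pa pb pd pe c3 : ℂ) (n : ℕ) : ℂ :=
  (2 * pa * c3 + pb) * gammaN q n + (pd * c3 + pe) * alphaN q n

noncomputable def phiK (q : ℝ) (pa pb pc pd pe c1 c2 c3 : ℂ) (n : ℕ) (z : ℂ) : ℂ :=
  (pd * (alphaL q ^ 2 - 1) * gammaN q (2 * n) + pa * alphaN q (2 * n)) * ((z - c3) ^ 2 - 2 * c1 * c2)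
  + ((2 * pa * c3 + pb) * alphaN q n + (pd * c3 + pe) * (alphaL q ^ 2 - 1) * gammaN q n) * (z - c3)
  + (pa * c3 ^ 2 + pb * c3 + pc) + 2 * pa * c1 * c2

/-- The algebraic rules obeyed by the divided difference and averaging operators of a
q-quadratic lattice, with `Y` the centred variable. -/
structure IsLatticePair (α m : ℂ) (Y : ℂ[X]) (D S : ℂ[X] → ℂ[X]) : Prop where
  D_add : ∀ f g, D (f + g) = D f + D g
  S_add : ∀ f g, S (f + g) = S f + S g
  D_C : ∀ a, D (C a) = 0
  S_C : ∀ a, S (C a) = C a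
  D_Y : D Y = 1
  S_Y : S Y = C α * Y
  D_mul : ∀ f g, D (f * g) = D f * S g + S f * D g
  S_mul : ∀ f g, S (f * g) = S f * S g + C (α ^ 2 - 1) * (Y * Y - C (4 * m)) * (D f * D g)

namespace IsLatticePair

variable {α m : ℂ} {Y : ℂ[X]} {D S : ℂ[X] → ℂ[X]}

theorem D_C_mul (h : IsLatticePair α m Y D S) (a : ℂ) (f : ℂ[X]) : D (C a * f) = C a * D f := by
  rw [h.D_mul, h.D_C, h.S_C]; ring

theorem S_C_mul (h : IsLatticePair α m Y D S) (a : ℂ) (f : ℂ[X]) : S (C a * f) = C a * S f := by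
  rw [h.S_mul, h.D_C, h.S_C]; ring

theorem D_sub (h : IsLatticePair α m Y D S) (f g : ℂ[X]) : D (f - g) = D f - D g := by
  have e : f - g = f + C (-1) * g := by simp [sub_eq_add_neg]
  rw [e, h.D_add, h.D_C_mul]; simp [sub_eq_add_neg]

theorem S_sub (h : IsLatticePair α m Y D S) (f g : ℂ[X]) : S (f - g) = S f - S g := by
  have e : f - g = f + C (-1) * g := by simp [sub_eq_add_neg]
  rw [e, h.S_add, h.S_C_mul]; simp [sub_eq_add_neg]

/-- A polynomial property stable under addition and multiplication by `X - c` holds everywhere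
once it holds for constants. -/
theorem _root_.Polynomial.induction_X_sub_C (c : ℂ) {p : ℂ[X] → Prop} (hC : ∀ a, p (C a))
    (hadd : ∀ f g, p f → p g → p (f + g)) (hmul : ∀ f, p f → p ((X - C c) * f)) (f : ℂ[X]) :
    p f := by
  have key : ∀ g : ℂ[X], p (g.comp (X - C c)) := by
    intro g
    induction g using Polynomial.induction_on with
    | C a => simpa using hC a
    | add f g hf hg => simpa using hadd _ _ hf hg
    | monomial n a ih =>
      have := hmul _ ih
      convert this using 1
      simp only [mul_comp, C_comp, pow_comp, X_comp]
      ring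
  have := key (f.comp (X + C c))
  rwa [comp_assoc, show (X + C c : ℂ[X]).comp (X - C c) = X by simp, comp_X] at this

theorem comm {c : ℂ} (h : IsLatticePair α m (X - C c) D S) (f : ℂ[X]) :
    D (S f) = C α * S (D f) + C (α ^ 2 - 1) * (X - C c) * D (D f) ∧
    S (S f) = C (α ^ 2 - 1) * (X - C c) * S (D f)
      + C α * (C (α ^ 2 - 1) * ((X - C c) * (X - C c) - C (4 * m))) * D (D f) + f := by
  induction f using Polynomial.induction_X_sub_C c with
  | hC a =>
    have h0 : D (0 : ℂ[X]) = 0 := by simpa using h.D_C 0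
    have h1 : S (0 : ℂ[X]) = 0 := by simpa using h.S_C 0
    simp [h.D_C, h.S_C, h0, h1]
  | hadd f g hf hg =>
    simp only [h.D_add, h.S_add, hf.1, hf.2, hg.1, hg.2]
    constructor <;> ring
  | hmul f ih =>
    obtain ⟨h1, h2⟩ := ih
    have hY := h.D_Y
    have sY := h.S_Y
    generalize (X - C c : ℂ[X]) = Y at *
    have D1 : D (1 : ℂ[X]) = 0 := by simpa using h.D_C 1
    have S1 : S (1 : ℂ[X]) = 1 := by simpa using h.S_C 1
    simp only [h.D_add, h.S_add, h.D_mul, h.S_mul, h.D_sub, h.S_sub, h.D_C, h.S_C, hY, sY, D1, S1,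
      h1, h2]
    simp only [map_sub, map_mul, map_pow, map_one, map_ofNat]
    constructor <;> ring

theorem adjoint_identity {c : ℂ} (h : IsLatticePair α m (X - C c) D S) (φ ψ f g : ℂ[X]) :
    g * (φ * D (D f) + ψ * S (D f)) =
      (φ * D (D f * S g) + ψ * S (D f * S g))
      - C α * (φ * D ((X - C c) * (D f * D g)) + ψ * S ((X - C c) * (D f * D g)))
      + (X - C c) * (φ * D (D f * D g) + ψ * S (D f * D g)) := by
  obtain ⟨h1, h2⟩ := h.comm g
  have hY := h.D_Y
  have sY := h.S_Y
  generalize (X - C c : ℂ[X]) = Y at *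
  simp only [h.D_mul, h.S_mul, hY, sY, h1, h2]
  simp only [map_sub, map_mul, map_pow, map_one, map_ofNat]
  ring

theorem next_identity {c : ℂ} (h : IsLatticePair α m (X - C c) D S) (pa pb pc pd pe : ℂ)
    {φ ψ φ' ψ' : ℂ[X]}
    (hφ : φ = C pa * ((X - C c) * (X - C c)) + C pb * (X - C c) + C pc)
    (hψ : ψ = C pd * (X - C c) + C pe)
    (hφ' : φ' = C (pd * (α ^ 2 - 1) * (2 * α) + pa * (2 * α ^ 2 - 1)) * ((X - C c) * (X - C c))
      + C (pb * α + pe * (α ^ 2 - 1)) * (X - C c)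
      + C (pc + 2 * m * pa - 2 * m * (pd * (α ^ 2 - 1) * (2 * α) + pa * (2 * α ^ 2 - 1))))
    (hψ' : ψ' = C (pa * (2 * α) + pd * (2 * α ^ 2 - 1)) * (X - C c) + C (pb + pe * α))
    (f : ℂ[X]) :
    (X - C c) * (φ * D (φ' * D f + ψ' * S f) + ψ * S (φ' * D f + ψ' * S f)) =
      φ * D (C α * ((X - C c) * (φ' * D f + ψ' * S f)) - φ' * S f
          - C (α ^ 2 - 1) * ((X - C c) * (X - C c) - C (4 * m)) * (ψ' * D f)) +
      ψ * S (C α * ((X - C c) * (φ' * D f + ψ' * S f)) - φ' * S f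
          - C (α ^ 2 - 1) * ((X - C c) * (X - C c) - C (4 * m)) * (ψ' * D f)) := by
  obtain ⟨h1, h2⟩ := h.comm f
  have hY := h.D_Y
  have sY := h.S_Y
  generalize (X - C c : ℂ[X]) = Y at *
  subst hφ hψ hφ' hψ'
  simp only [h.D_add, h.S_add, h.D_mul, h.S_mul, h.D_sub, h.S_sub, h.D_C, h.S_C, hY, sY, h1, h2]
  simp only [map_sub, map_add, map_mul, map_pow, map_one, map_ofNat]
  ring

end IsLatticePair

/-- The recurrences of the q-analogues `al n` of cosine and `ga n` of sine. -/
structure IsLatticeSeq (α : ℂ) (al ga : ℕ → ℂ) : Prop where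
  al_zero : al 0 = 1
  ga_zero : ga 0 = 0
  al_succ : ∀ n, al (n + 1) = α * al n + (α ^ 2 - 1) * ga n
  ga_succ : ∀ n, ga (n + 1) = α * ga n + al n
  ga_ne : ∀ n, ga (n + 1) ≠ 0

theorem IsLatticeSeq.sq_sub {α : ℂ} {al ga : ℕ → ℂ} (hs : IsLatticeSeq α al ga) (n : ℕ) :
    al n ^ 2 - (α ^ 2 - 1) * ga n ^ 2 = 1 := by
  induction n with
  | zero => simp [hs.al_zero, hs.ga_zero]
  | succ n ih => rw [hs.al_succ, hs.ga_succ]; linear_combination ih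

theorem natDegree_le_iff_degree_lt_succ {f : ℂ[X]} {n : ℕ} :
    f.natDegree ≤ n ↔ f.degree < ((n + 1 : ℕ) : WithBot ℕ) := by
  rw [natDegree_le_iff_coeff_eq_zero, degree_lt_iff_coeff_zero]
  rfl

theorem degree_lt_of_coeff_eq_zero {f : ℂ[X]} {n : ℕ} (hf : f.degree < ((n + 1 : ℕ) : WithBot ℕ))
    (h0 : f.coeff n = 0) : f.degree < (n : WithBot ℕ) := by
  rw [degree_lt_iff_coeff_zero] at hf ⊢
  intro k hk
  rcases hk.eq_or_lt with rfl | hk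
  · exact h0
  · exact hf k hk

theorem natDegree_sub_le_of_le_of_le {f g : ℂ[X]} {n : ℕ} (hf : f.natDegree ≤ n)
    (hg : g.natDegree ≤ n) : (f - g).natDegree ≤ n :=
  (natDegree_sub_le f g).trans (max_le hf hg)

theorem coeff_X_sub_C_mul_succ (c : ℂ) (f : ℂ[X]) (k : ℕ) :
    ((X - C c) * f).coeff (k + 1) = f.coeff k - c * f.coeff (k + 1) := by
  simp [sub_mul]

namespace IsLatticePair

variable {α m c : ℂ} {D S : ℂ[X] → ℂ[X]} {al ga : ℕ → ℂ}

theorem degree_coeff (h : IsLatticePair α m (X - C c) D S) (hs : IsLatticeSeq α al ga) (n : ℕ) :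
    ∀ f : ℂ[X], f.natDegree ≤ n →
      (D f).degree < (n : WithBot ℕ) ∧ (S f).natDegree ≤ n ∧
      (∀ k, n = k + 1 → (D f).coeff k = ga n * f.coeff n) ∧ (S f).coeff n = al n * f.coeff n := by
  induction n with
  | zero =>
    intro f hf
    rw [eq_C_of_natDegree_le_zero hf]
    simp [h.D_C, h.S_C, hs.al_zero]
  | succ n ih =>
    intro f hf
    obtain ⟨g, a, hg, rfl⟩ : ∃ g a, g.natDegree ≤ n ∧ f = (X - C c) * g + C a := by
      refine ⟨f /ₘ (X - C c), f.eval c, ?_, ?_⟩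
      · rw [natDegree_divByMonic _ (monic_X_sub_C c), natDegree_X_sub_C]; omega
      · rw [← modByMonic_X_sub_C_eq_C_eval, add_comm, modByMonic_add_div]
    obtain ⟨h1, h2, h3, h4⟩ := ih g hg
    have eD : D ((X - C c) * g + C a) = S g + C α * ((X - C c) * D g) := by
      rw [h.D_add, h.D_mul, h.D_Y, h.S_Y, h.D_C]; ring
    have eS : S ((X - C c) * g + C a) = C α * ((X - C c) * S g)
        + C (α ^ 2 - 1) * ((X - C c) * ((X - C c) * D g) - C (4 * m) * D g) + C a := by
      rw [h.S_add, h.S_mul, h.D_Y, h.S_Y, h.S_C]; ring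
    rw [degree_lt_iff_coeff_zero] at h1
    rw [natDegree_le_iff_coeff_eq_zero] at hg h2
    have g0 : g.coeff (n + 1) = 0 := hg _ (by omega)
    have key : ∀ j, n ≤ j → ((X - C c) * D g).coeff j = if j = n then ga n * g.coeff n else 0 := by
      intro j hj
      rcases j with _ | j
      · obtain rfl : n = 0 := by omega
        simp [hs.ga_zero, h1 0 le_rfl, mul_coeff_zero]
      · rw [coeff_X_sub_C_mul_succ, h1 (j + 1) hj]
        split_ifs with hjn
        · subst hjn; rw [h3 j rfl]; ring
        · rw [h1 j (by omega)]; ring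
    rw [eD, eS, degree_lt_iff_coeff_zero, natDegree_le_iff_coeff_eq_zero]
    refine ⟨?_, ?_, ?_, ?_⟩
    · intro k hk
      have e := key k (by omega)
      rw [if_neg (by omega)] at e
      rw [coeff_add, coeff_C_mul, e, h2 k (by omega)]; ring
    · intro k hk
      obtain ⟨j, rfl⟩ : ∃ j, k = j + 1 := ⟨k - 1, by omega⟩
      have e1 := key j (by omega)
      have e2 := key (j + 1) (by omega)
      rw [if_neg (by omega)] at e1 e2
      simp only [coeff_add, coeff_sub, coeff_C_mul, coeff_C_succ, coeff_X_sub_C_mul_succ] at e1 e2 ⊢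
      rw [← coeff_X_sub_C_mul_succ c (D g) j] at *
      rw [e1, e2, h2 j (by omega), h2 (j + 1) (by omega), h1 (j + 1) (by omega)]
      ring
    · intro k hk
      obtain rfl : n = k := by omega
      have e := key n le_rfl
      rw [if_pos rfl] at e
      rw [coeff_add, coeff_C_mul, e, h4, coeff_add, coeff_X_sub_C_mul_succ, coeff_C_succ, g0,
        hs.ga_succ]
      ring
    · have e1 := key n le_rfl
      have e2 := key (n + 1) (by omega)
      rw [if_pos rfl] at e1
      rw [if_neg (by omega)] at e2
      rw [coeff_add, coeff_add, coeff_C_mul, coeff_C_mul, coeff_sub, coeff_C_mul,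
        coeff_X_sub_C_mul_succ, coeff_X_sub_C_mul_succ, e1, e2, h4, h2 (n + 1) (by omega),
        h1 (n + 1) (by omega), coeff_add, coeff_X_sub_C_mul_succ, coeff_C_succ, g0, hs.al_succ]
      ring

theorem exists_D_eq (h : IsLatticePair α m (X - C c) D S) (hs : IsLatticeSeq α al ga) (n : ℕ) :
    ∀ g : ℂ[X], g.degree < (n : WithBot ℕ) → ∃ f : ℂ[X], f.natDegree ≤ n ∧ D f = g := by
  induction n with
  | zero =>
    intro g hg
    have : g = 0 := by simpa using hg
    exact ⟨C 0, by simp, by rw [h.D_C, this]⟩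
  | succ n ih =>
    intro g hg
    have hF : (C (g.coeff n / ga (n + 1)) * X ^ (n + 1) : ℂ[X]).natDegree ≤ n + 1 :=
      natDegree_C_mul_X_pow_le _ _
    obtain ⟨h1, -, h3, -⟩ := h.degree_coeff hs (n + 1) _ hF
    have hD := h3 n rfl
    rw [coeff_C_mul_X_pow, if_pos rfl, mul_div_cancel₀ _ (hs.ga_ne n)] at hD
    obtain ⟨f, hf, hDf⟩ := ih (g - D (C (g.coeff n / ga (n + 1)) * X ^ (n + 1)))
      (degree_lt_of_coeff_eq_zero ((degree_sub_le _ _).trans_lt (max_lt hg h1))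
        (by rw [coeff_sub, hD, sub_self]))
    refine ⟨f + C (g.coeff n / ga (n + 1)) * X ^ (n + 1),
      natDegree_add_le_of_degree_le (hf.trans n.le_succ) hF, ?_⟩
    rw [h.D_add, hDf]; ring

/-- The second order operator `φ D² + ψ S D` is triangular on degrees. -/
theorem hypergeometric_degree_coeff (h : IsLatticePair α m (X - C c) D S)
    (hs : IsLatticeSeq α al ga) (a b e d l : ℂ) (n : ℕ) (f : ℂ[X]) (hf : f.natDegree ≤ n + 1) :
    ((C a * ((X - C c) * (X - C c)) + C b * (X - C c) + C e) * D (D f)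
        + (C d * (X - C c) + C l) * S (D f)).natDegree ≤ n + 1 ∧
    ((C a * ((X - C c) * (X - C c)) + C b * (X - C c) + C e) * D (D f)
        + (C d * (X - C c) + C l) * S (D f)).coeff (n + 1)
      = ga (n + 1) * (a * ga n + d * al n) * f.coeff (n + 1) := by
  obtain ⟨h1, -, h3, -⟩ := h.degree_coeff hs (n + 1) _ hf
  have hD := h3 n rfl
  obtain ⟨k1, k2, k3, k4⟩ := h.degree_coeff hs n _ (natDegree_le_iff_degree_lt_succ.2 h1)
  set g := D f
  rw [degree_lt_iff_coeff_zero] at k1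
  rw [natDegree_le_iff_coeff_eq_zero] at k2
  have key : ∀ j, n ≤ j → ((X - C c) * D g).coeff j = if j = n then ga n * g.coeff n else 0 := by
    intro j hj
    rcases j with _ | j
    · obtain rfl : n = 0 := by omega
      simp [hs.ga_zero, k1 0 le_rfl, mul_coeff_zero]
    · rw [coeff_X_sub_C_mul_succ, k1 (j + 1) hj]
      split_ifs with hjn
      · subst hjn; rw [k3 j rfl]; ring
      · rw [k1 j (by omega)]; ring
  have eq : (C a * ((X - C c) * (X - C c)) + C b * (X - C c) + C e) * D g
        + (C d * (X - C c) + C l) * S g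
      = C a * ((X - C c) * ((X - C c) * D g)) + C b * ((X - C c) * D g) + C e * D g
        + C d * ((X - C c) * S g) + C l * S g := by ring
  have full : ∀ j, n ≤ j → ((C a * ((X - C c) * (X - C c)) + C b * (X - C c) + C e) * D g
        + (C d * (X - C c) + C l) * S g).coeff (j + 1)
      = if j = n then ga (n + 1) * (a * ga n + d * al n) * f.coeff (n + 1) else 0 := by
    intro j hj
    have e1 := key j hj
    have e2 := key (j + 1) (by omega)
    rw [if_neg (by omega)] at e2
    rw [eq, coeff_add, coeff_add, coeff_add, coeff_add, coeff_C_mul, coeff_C_mul, coeff_C_mul,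
      coeff_C_mul, coeff_C_mul, coeff_X_sub_C_mul_succ, coeff_X_sub_C_mul_succ c (S g), e1, e2,
      k1 (j + 1) (by omega), k2 (j + 1) (by omega)]
    split_ifs with hjn
    · subst hjn; rw [k4, hD]; ring
    · rw [k2 j (by omega)]; ring
  refine ⟨?_, by rw [full n le_rfl, if_pos rfl]⟩
  rw [natDegree_le_iff_coeff_eq_zero]
  intro k hk
  obtain ⟨j, rfl⟩ : ∃ j, k = j + 1 := ⟨k - 1, by omega⟩
  rw [full j (by omega), if_neg (by omega)]

end IsLatticePair

namespace IsLatticePair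

variable {α m c : ℂ} {D S : ℂ[X] → ℂ[X]} {al ga : ℕ → ℂ}

/-- The functional `f ↦ v ((X - c) (φ D f + ψ S f))`, which plays the role of `φ v` in the
differential case. -/
noncomputable def nextFunctional {Y : ℂ[X]} (h : IsLatticePair α m Y D S) (φ ψ : ℂ[X])
    (v : ℂ[X] →ₗ[ℂ] ℂ) : ℂ[X] →ₗ[ℂ] ℂ where
  toFun f := v (Y * (φ * D f + ψ * S f))
  map_add' f g := by
    rw [← map_add, h.D_add, h.S_add]; congr 1; ring
  map_smul' r f := by
    rw [RingHom.id_apply, ← map_smul, smul_eq_C_mul, smul_eq_C_mul, h.D_C_mul, h.S_C_mul]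
    congr 1; ring

theorem map_C_mul (v : ℂ[X] →ₗ[ℂ] ℂ) (r : ℂ) (f : ℂ[X]) : v (C r * f) = r * v f := by
  rw [← smul_eq_C_mul, map_smul, smul_eq_mul]

theorem apply_mul_hypergeometric (h : IsLatticePair α m (X - C c) D S) {φ ψ : ℂ[X]}
    {v : ℂ[X] →ₗ[ℂ] ℂ} (hv : ∀ f, v (φ * D f + ψ * S f) = 0) (f g : ℂ[X]) :
    v (g * (φ * D (D f) + ψ * S (D f))) = h.nextFunctional φ ψ v (D f * D g) := by
  rw [h.adjoint_identity, map_add, map_sub, map_C_mul, hv, hv]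
  simp [nextFunctional]

theorem nextFunctional_pearson (h : IsLatticePair α m (X - C c) D S) (pa pb pc pd pe : ℂ)
    {v : ℂ[X] →ₗ[ℂ] ℂ} {φ ψ φ' ψ' : ℂ[X]}
    (hv : ∀ f, v (φ * D f + ψ * S f) = 0)
    (hφ : φ = C pa * ((X - C c) * (X - C c)) + C pb * (X - C c) + C pc)
    (hψ : ψ = C pd * (X - C c) + C pe)
    (hφ' : φ' = C (pd * (α ^ 2 - 1) * (2 * α) + pa * (2 * α ^ 2 - 1)) * ((X - C c) * (X - C c))
      + C (pb * α + pe * (α ^ 2 - 1)) * (X - C c)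
      + C (pc + 2 * m * pa - 2 * m * (pd * (α ^ 2 - 1) * (2 * α) + pa * (2 * α ^ 2 - 1))))
    (hψ' : ψ' = C (pa * (2 * α) + pd * (2 * α ^ 2 - 1)) * (X - C c) + C (pb + pe * α))
    (f : ℂ[X]) :
    h.nextFunctional φ ψ v (φ' * D f + ψ' * S f) = 0 := by
  show v _ = 0
  rw [h.next_identity pa pb pc pd pe hφ hψ hφ' hψ', hv]

theorem nextFunctional_one (h : IsLatticePair α m (X - C c) D S) {pa pb pc pd pe : ℂ}
    {v : ℂ[X] →ₗ[ℂ] ℂ} {φ ψ : ℂ[X]}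
    (hv : ∀ f, v (φ * D f + ψ * S f) = 0)
    (hφ : φ = C pa * ((X - C c) * (X - C c)) + C pb * (X - C c) + C pc)
    (hψ : ψ = C pd * (X - C c) + C pe) (hd : pd ≠ 0) :
    (pa + pd * α) * h.nextFunctional φ ψ v 1
      = -(pd * (pa * (pe / pd) ^ 2 - pb * (pe / pd) + pc)) * v 1 := by
  have D1 : D (1 : ℂ[X]) = 0 := by simpa using h.D_C 1
  have S1 : S (1 : ℂ[X]) = 1 := by simpa using h.S_C 1
  have e1 := hv 1
  have e2 := hv (X - C c)
  rw [D1, S1] at e1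
  rw [h.D_Y, h.S_Y] at e2
  have e3 : h.nextFunctional φ ψ v 1 = v ((X - C c) * ψ) := by
    show v _ = _
    rw [D1, S1]; congr 1; ring
  rw [e3]
  subst hφ hψ
  generalize (X - C c : ℂ[X]) = Y at *
  have q1 : v ((C pa * (Y * Y) + C pb * Y + C pc) * 0 + (C pd * Y + C pe) * 1)
      = pd * v Y + pe * v 1 := by
    rw [← map_C_mul, ← map_C_mul, ← map_add]; congr 1; ring
  have q2 : v ((C pa * (Y * Y) + C pb * Y + C pc) * 1 + (C pd * Y + C pe) * (C α * Y))
      = pa * v (Y * Y) + pb * v Y + pc * v 1 + α * (pd * v (Y * Y) + pe * v Y) := by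
    simp only [← map_C_mul, ← map_add]; congr 1; ring
  have q3 : v (Y * (C pd * Y + C pe)) = pd * v (Y * Y) + pe * v Y := by
    simp only [← map_C_mul, ← map_add]; congr 1; ring
  rw [q1] at e1
  rw [q2] at e2
  rw [q3]
  field_simp
  linear_combination pd ^ 2 * e2 + (pa * pe - pd * pb) * e1

theorem exists_hypergeometric_eq (h : IsLatticePair α m (X - C c) D S)
    (hs : IsLatticeSeq α al ga) {a b e d l : ℂ} (hne : ∀ n, a * ga n + d * al n ≠ 0) (n : ℕ) :
    ∀ f : ℂ[X], f.natDegree ≤ n → ∃ (g : ℂ[X]) (r : ℂ), g.natDegree ≤ n ∧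
      f = ((C a * ((X - C c) * (X - C c)) + C b * (X - C c) + C e) * D (D g)
        + (C d * (X - C c) + C l) * S (D g)) + C r := by
  induction n with
  | zero =>
    intro f hf
    refine ⟨C 0, f.coeff 0, by simp, ?_⟩
    have D0 : D (0 : ℂ[X]) = 0 := by simpa using h.D_C 0
    have S0 : S (0 : ℂ[X]) = 0 := by simpa using h.S_C 0
    rw [h.D_C, D0, S0]
    simpa using eq_C_of_natDegree_le_zero hf
  | succ n ih =>
    intro f hf
    set r := f.coeff (n + 1) / (ga (n + 1) * (a * ga n + d * al n)) with hr
    have hF : (C r * X ^ (n + 1) : ℂ[X]).natDegree ≤ n + 1 := natDegree_C_mul_X_pow_le _ _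
    obtain ⟨h1, h2⟩ := h.hypergeometric_degree_coeff hs a b e d l n _ hF
    rw [coeff_C_mul_X_pow, if_pos rfl, hr,
      mul_div_cancel₀ _ (mul_ne_zero (hs.ga_ne n) (hne n)), ← hr] at h2
    obtain ⟨g, t, hg, hfg⟩ := ih (f - _) (natDegree_le_iff_degree_lt_succ.2 (degree_lt_of_coeff_eq_zero
      (natDegree_le_iff_degree_lt_succ.1 (natDegree_sub_le_of_le_of_le hf h1))
      (by rw [coeff_sub, h2, sub_self])))
    refine ⟨g + C r * X ^ (n + 1), t, natDegree_add_le_of_degree_le (hg.trans n.le_succ) hF, ?_⟩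
    rw [h.D_add, h.D_add, h.S_add]
    linear_combination hfg

theorem exists_monic_orthogonal (h : IsLatticePair α m (X - C c) D S)
    (hs : IsLatticeSeq α al ga) (a b e d l : ℕ → ℂ)
    (hne : ∀ k n, a k * ga n + d k * al n ≠ 0)
    (ha : ∀ k, a (k + 1) = d k * (α ^ 2 - 1) * (2 * α) + a k * (2 * α ^ 2 - 1))
    (hb : ∀ k, b (k + 1) = b k * α + l k * (α ^ 2 - 1))
    (he : ∀ k, e (k + 1) = e k + 2 * m * a k - 2 * m * a (k + 1))
    (hd : ∀ k, d (k + 1) = a k * (2 * α) + d k * (2 * α ^ 2 - 1))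
    (hl : ∀ k, l (k + 1) = b k + l k * α) (n : ℕ) :
    ∀ (k : ℕ) (v : ℂ[X] →ₗ[ℂ] ℂ),
      (∀ f, v ((C (a k) * ((X - C c) * (X - C c)) + C (b k) * (X - C c) + C (e k)) * D f
        + (C (d k) * (X - C c) + C (l k)) * S f) = 0) →
      ∃ P : ℂ[X], P.Monic ∧ P.natDegree = n ∧
        (∀ g : ℂ[X], g.degree < (n : WithBot ℕ) → v (P * g) = 0) ∧
        (v (P * P) ≠ 0 ↔ v 1 ≠ 0 ∧ ∀ j < n,
          a (k + j) * (l (k + j) / d (k + j)) ^ 2 - b (k + j) * (l (k + j) / d (k + j))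
            + e (k + j) ≠ 0) := by
  induction n with
  | zero =>
    intro k v _
    refine ⟨1, monic_one, natDegree_one, ?_, by simp⟩
    intro g hg
    have : g = 0 := by simpa using hg
    simp [this]
  | succ n ih =>
    intro k v hv
    have hvL := h.apply_mul_hypergeometric hv
    have hv1 := h.nextFunctional_one hv rfl rfl (by simpa [hs.ga_zero, hs.al_zero] using hne k 0)
    have hpn := h.nextFunctional_pearson (a k) (b k) (e k) (d k) (l k) hv rfl rfl
      (φ' := C (a (k + 1)) * ((X - C c) * (X - C c)) + C (b (k + 1)) * (X - C c) + C (e (k + 1)))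
      (ψ' := C (d (k + 1)) * (X - C c) + C (l (k + 1)))
      (by rw [he, ha, hb]) (by rw [hd, hl])
    have hsurj := h.exists_hypergeometric_eq hs (b := b k) (e := e k) (l := l k) (hne k)
    have hLdeg := h.hypergeometric_degree_coeff hs (a k) (b k) (e k) (d k) (l k) n
    generalize h.nextFunctional _ _ v = w at *
    generalize C (a k) * ((X - C c) * (X - C c)) + C (b k) * (X - C c) + C (e k) = φ at *
    generalize C (d k) * (X - C c) + C (l k) = ψ at *
    obtain ⟨Q, hQm, hQn, hQo, hQi⟩ := ih (k + 1) w hpn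
    have hgn := hs.ga_ne n
    obtain ⟨P₀, hP₀, hDP₀⟩ := h.exists_D_eq hs (n + 1) (C (ga (n + 1)) * Q)
      (natDegree_le_iff_degree_lt_succ.1 ((natDegree_C_mul_le _ _).trans hQn.le))
    have hcoef : P₀.coeff (n + 1) = 1 := by
      have := (h.degree_coeff hs (n + 1) _ hP₀).2.2.1 n rfl
      rw [hDP₀, coeff_C_mul, show Q.coeff n = 1 by rw [← hQn]; exact hQm] at this
      exact (mul_left_cancel₀ hgn this).symm
    have hone : ∀ f, f.natDegree ≤ n + 1 → v 1 = 0 → v f = 0 := by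
      intro f hf h1
      obtain ⟨g, r, -, rfl⟩ := hsurj (n + 1) f hf
      rw [map_add, hv, ← mul_one (C r), map_C_mul, h1]; simp
    obtain ⟨κ, hκ⟩ : ∃ κ, v (P₀ - C κ) = 0 := by
      by_cases h1 : v 1 = 0
      · exact ⟨0, by simpa using hone P₀ hP₀ h1⟩
      · refine ⟨v P₀ / v 1, ?_⟩
        rw [map_sub, ← mul_one (C _), map_C_mul, div_mul_cancel₀ _ h1, sub_self]
    set P := P₀ - C κ with hP
    have hDP : D P = C (ga (n + 1)) * Q := by rw [hP, h.D_sub, h.D_C, hDP₀, sub_zero]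
    have hPc : P.coeff (n + 1) = 1 := by rw [hP, coeff_sub, coeff_C_succ, hcoef, sub_zero]
    have hPd : P.natDegree ≤ n + 1 :=
      natDegree_sub_le_of_le_of_le hP₀ ((natDegree_C κ).le.trans (Nat.zero_le _))
    have horth : ∀ g : ℂ[X], g.degree < ((n + 1 : ℕ) : WithBot ℕ) → v (P * g) = 0 := by
      intro g hg
      obtain ⟨g', r, hg', rfl⟩ := hsurj n g (natDegree_le_iff_degree_lt_succ.2 hg)
      rw [mul_add, map_add, hvL, mul_comm P, map_C_mul, hκ, hDP,
        show D g' * (C (ga (n + 1)) * Q) = C (ga (n + 1)) * (Q * D g') by ring, map_C_mul,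
        hQo _ (h.degree_coeff hs n g' hg').1]
      simp
    obtain ⟨hL1, hL2⟩ := hLdeg P hPd
    rw [hPc, mul_one] at hL2
    set lam := ga (n + 1) * (a k * ga n + d k * al n) with hlam
    have hlam0 : lam ≠ 0 := mul_ne_zero hgn (hne k n)
    have hnorm : lam * v (P * P) = ga (n + 1) ^ 2 * w (Q * Q) := by
      have h0 := horth (C lam * P - (φ * D (D P) + ψ * S (D P)))
        (degree_lt_of_coeff_eq_zero (natDegree_le_iff_degree_lt_succ.1
          (natDegree_sub_le_of_le_of_le ((natDegree_C_mul_le _ _).trans hPd) hL1))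
          (by rw [coeff_sub, coeff_C_mul, hPc, hL2, mul_one, sub_self]))
      rw [mul_sub, map_sub, hvL, hDP, show P * (C lam * P) = C lam * (P * P) by ring, map_C_mul,
        show C (ga (n + 1)) * Q * (C (ga (n + 1)) * Q)
          = C (ga (n + 1)) * (C (ga (n + 1)) * (Q * Q)) by ring, map_C_mul, map_C_mul] at h0
      linear_combination h0
    have hiff : v (P * P) ≠ 0 ↔ w (Q * Q) ≠ 0 := by
      rw [← mul_ne_zero_iff_left hlam0, hnorm,
        mul_ne_zero_iff_left (pow_ne_zero 2 hgn)]
    have h1 := hne k 1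
    have hd0 := hne k 0
    rw [show (1 : ℕ) = 0 + 1 from rfl, hs.ga_succ, hs.al_succ, hs.ga_zero, hs.al_zero] at h1
    rw [hs.ga_zero, hs.al_zero] at hd0
    have hw1 : w 1 ≠ 0 ↔ a k * (l k / d k) ^ 2 - b k * (l k / d k) + e k ≠ 0 ∧ v 1 ≠ 0 := by
      have h1' : a k + d k * α ≠ 0 := by convert h1 using 1; ring
      have hd0' : d k ≠ 0 := by convert hd0 using 1; ring
      rw [← mul_ne_zero_iff_left h1', hv1, mul_ne_zero_iff, neg_ne_zero, mul_ne_zero_iff]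
      tauto
    refine ⟨P, monic_of_natDegree_le_of_coeff_eq_one _ hPd hPc,
      natDegree_eq_of_le_of_coeff_ne_zero hPd (by rw [hPc]; exact one_ne_zero), horth, ?_⟩
    rw [hiff, hQi, hw1]
    constructor
    · rintro ⟨⟨p1, p2⟩, p3⟩
      refine ⟨p2, fun j hj => ?_⟩
      rcases j with _ | j
      · exact p1
      · have := p3 j (by omega)
        rwa [show k + 1 + j = k + (j + 1) by ring] at this
    · rintro ⟨p1, p2⟩
      refine ⟨⟨p2 0 (by omega), p1⟩, fun j hj => ?_⟩
      rw [show k + 1 + j = k + (j + 1) by ring]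
      exact p2 (j + 1) (by omega)

end IsLatticePair

theorem IsRegularFunc.exists_orthogonal {u : ℂ[X] →ₗ[ℂ] ℂ} (hu : IsRegularFunc u) :
    ∃ P : ℕ → ℂ[X], (∀ n, (P n).Monic) ∧ (∀ n, (P n).natDegree = n) ∧
      (∀ (n : ℕ) (g : ℂ[X]), g.degree < (n : WithBot ℕ) → u (P n * g) = 0) ∧
      (∀ n, u (P n * P n) ≠ 0) := by
  obtain ⟨P, h1, h2, h3, h4⟩ := hu
  refine ⟨P, h1, h2, ?_, h4⟩
  intro n
  have key : ∀ k ≤ n, ∀ g : ℂ[X], g.degree < (k : WithBot ℕ) → u (P n * g) = 0 := by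
    intro k
    induction k with
    | zero =>
      intro _ g hg
      have : g = 0 := by simpa using hg
      simp [this]
    | succ k ih =>
      intro hk g hg
      have hc : (P k).coeff k = 1 := by
        have := (h1 k).coeff_natDegree
        rwa [h2 k] at this
      have := ih (by omega) (g - C (g.coeff k) * P k) (degree_lt_of_coeff_eq_zero
        (natDegree_le_iff_degree_lt_succ.1 (natDegree_sub_le_of_le_of_le
          (natDegree_le_iff_degree_lt_succ.2 hg) ((natDegree_C_mul_le _ _).trans (h2 k).le)))
        (by rw [coeff_sub, coeff_C_mul, hc, mul_one, sub_self]))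
      rw [mul_sub, map_sub, show P n * (C (g.coeff k) * P k) = C (g.coeff k) * (P n * P k) by ring,
        IsLatticePair.map_C_mul, h3 n k (by omega)] at this
      simpa using this
  exact key n le_rfl

theorem IsRegularFunc.eq_zero {u : ℂ[X] →ₗ[ℂ] ℂ} (hu : IsRegularFunc u) (n : ℕ) :
    ∀ R : ℂ[X], R.degree < (n : WithBot ℕ) →
      (∀ g : ℂ[X], g.degree < (n : WithBot ℕ) → u (g * R) = 0) → R = 0 := by
  obtain ⟨P, h1, h2, h3, h4⟩ := hu.exists_orthogonal
  induction n with
  | zero => intro R hR _; simpa using hR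
  | succ n ih =>
    intro R hR hg
    have hc : (P n).coeff n = 1 := by
      have := (h1 n).coeff_natDegree
      rwa [h2 n] at this
    have hRn : R.coeff n = 0 := by
      have e1 := h3 n (R - C (R.coeff n) * P n) (degree_lt_of_coeff_eq_zero
        (natDegree_le_iff_degree_lt_succ.1 (natDegree_sub_le_of_le_of_le
          (natDegree_le_iff_degree_lt_succ.2 hR) ((natDegree_C_mul_le _ _).trans (h2 n).le)))
        (by rw [coeff_sub, coeff_C_mul, hc, mul_one, sub_self]))
      rw [mul_sub, map_sub, hg _ (natDegree_le_iff_degree_lt_succ.1 (h2 n).le),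
        show P n * (C (R.coeff n) * P n) = C (R.coeff n) * (P n * P n) by ring,
        IsLatticePair.map_C_mul, zero_sub, neg_eq_zero] at e1
      exact (mul_eq_zero.1 e1).resolve_right (h4 n)
    exact ih R (degree_lt_of_coeff_eq_zero hR hRn) fun g hg' =>
      hg g (hg'.trans (by exact_mod_cast n.lt_succ_self))

theorem IsRegularFunc.eq_zero_of_forall {u : ℂ[X] →ₗ[ℂ] ℂ} (hu : IsRegularFunc u) (R : ℂ[X])
    (hR : ∀ g, u (g * R) = 0) : R = 0 :=
  hu.eq_zero (R.natDegree + 1) R (natDegree_le_iff_degree_lt_succ.1 le_rfl) fun g _ => hR g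

theorem IsLatticePair.lead_ne_zero {α m c : ℂ} {D S : ℂ[X] → ℂ[X]} {al ga : ℕ → ℂ}
    (h : IsLatticePair α m (X - C c) D S) (hs : IsLatticeSeq α al ga) {a b e d l : ℂ}
    {u : ℂ[X] →ₗ[ℂ] ℂ} (hu : IsRegularFunc u) {φ ψ : ℂ[X]}
    (hφ : φ = C a * ((X - C c) * (X - C c)) + C b * (X - C c) + C e)
    (hψ : ψ = C d * (X - C c) + C l)
    (hv : ∀ f, u (φ * D f + ψ * S f) = 0) (hne : ¬(φ = 0 ∧ ψ = 0)) (n : ℕ) :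
    a * ga n + d * al n ≠ 0 := by
  intro hzero
  obtain ⟨P, hPm, hPn, hPo, hPP⟩ := hu.exists_orthogonal
  have hvL := h.apply_mul_hypergeometric hv
  have hLdeg := fun k => h.hypergeometric_degree_coeff hs a b e d l k
  simp only [← hφ, ← hψ] at hLdeg
  have hPd : (P (n + 1)).natDegree ≤ n + 1 := (hPn _).le
  set G := D (P (n + 1)) with hG
  have hL0 : φ * D G + ψ * S G = 0 := by
    obtain ⟨h1, h2⟩ := hLdeg n _ hPd
    rw [hzero] at h2
    refine hu.eq_zero (n + 1) _ (degree_lt_of_coeff_eq_zero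
      (natDegree_le_iff_degree_lt_succ.1 h1) (by rw [h2]; ring)) fun g hg => ?_
    rw [hvL, mul_comm, ← hvL]
    refine hPo _ _ ?_
    rw [← natDegree_le_iff_degree_lt_succ] at hg ⊢
    rcases n with _ | n
    · have D0 : D (0 : ℂ[X]) = 0 := by simpa using h.D_C 0
      have S0 : S (0 : ℂ[X]) = 0 := by simpa using h.S_C 0
      rw [eq_C_of_natDegree_le_zero hg, h.D_C, D0, S0]
      simp
    · exact (hLdeg n g hg).1
  set U₂ : ℂ[X] := C (α ^ 2 - 1) * ((X - C c) * (X - C c) - C (4 * m)) with hU₂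
  have hφ0 : φ * S G + ψ * (U₂ * D G) = 0 := by
    refine hu.eq_zero_of_forall _ fun g => ?_
    obtain ⟨f, -, rfl⟩ := h.exists_D_eq hs _ g
      (natDegree_le_iff_degree_lt_succ.1 (le_refl g.natDegree))
    have := hv (G * f)
    rw [h.D_mul, h.S_mul] at this
    rw [← this]
    congr 1
    linear_combination (-S f) * hL0
  have hGd := h.degree_coeff hs (n + 1) _ hPd
  have hGc : G.coeff n = ga (n + 1) := by
    have h1 := (hPm (n + 1)).coeff_natDegree
    rw [hPn] at h1
    rw [hGd.2.2.1 n rfl, h1, mul_one]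
  obtain ⟨g1, g2, g3, g4⟩ := h.degree_coeff hs n G (natDegree_le_iff_degree_lt_succ.2 hGd.1)
  have hdet : S G * S G - U₂ * (D G * D G) ≠ 0 := by
    intro h0
    have e1 : (S G * S G).coeff (n + n) = al n ^ 2 * ga (n + 1) ^ 2 := by
      rw [coeff_mul_add_eq_of_natDegree_le g2 g2, g4, hGc]; ring
    have e2 : (U₂ * (D G * D G)).coeff (n + n) = (α ^ 2 - 1) * ga n ^ 2 * ga (n + 1) ^ 2 := by
      rcases n with _ | n
      · have : D G = 0 := by simpa using g1
        simp [this, hs.ga_zero]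
      · have hD : (D G).natDegree ≤ n := natDegree_le_iff_degree_lt_succ.2 g1
        have hY : (X - C c : ℂ[X]).natDegree ≤ 1 := natDegree_X_sub_C_le c
        have hYc : (X - C c : ℂ[X]).coeff 1 = 1 := by simp
        have hYD : ((X - C c) * D G).natDegree ≤ 1 + n := natDegree_mul_le_of_le hY hD
        have r : U₂ * (D G * D G) = C (α ^ 2 - 1) * (((X - C c) * D G) * ((X - C c) * D G)
          - C (4 * m) * (D G * D G)) := by rw [hU₂]; ring
        have hz : (D G * D G).coeff (1 + n + (1 + n)) = 0 :=
          coeff_eq_zero_of_natDegree_lt ((natDegree_mul_le_of_le hD hD).trans_lt (by omega))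
        rw [r, show n + 1 + (n + 1) = 1 + n + (1 + n) by ring, coeff_C_mul, coeff_sub, coeff_C_mul,
          coeff_mul_add_eq_of_natDegree_le hYD hYD, coeff_mul_add_eq_of_natDegree_le hY hD, hYc, hz, g3 n rfl,
          hGc]
        ring
    have e3 := congrArg (fun p => p.coeff (n + n)) h0
    simp only [coeff_sub, e1, e2, coeff_zero] at e3
    exact pow_ne_zero 2 (hs.ga_ne n) (by linear_combination e3 - ga (n + 1) ^ 2 * hs.sq_sub n)
  refine hne ⟨?_, ?_⟩
  · refine (mul_eq_zero.1 ?_).resolve_left hdet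
    linear_combination S G * hφ0 - U₂ * D G * hL0
  · refine (mul_eq_zero.1 ?_).resolve_left hdet
    linear_combination S G * hL0 - D G * hφ0

theorem qp_add (q : ℝ) (s t : ℂ) : qp q (s + t) = qp q s * qp q t := by
  rw [qp, add_mul, Complex.exp_add]; rfl

theorem qp_neg (q : ℝ) (s : ℂ) : qp q (-s) = (qp q s)⁻¹ := by
  rw [qp, neg_mul, Complex.exp_neg]; rfl

theorem qp_ne_zero (q : ℝ) (s : ℂ) : qp q s ≠ 0 := Complex.exp_ne_zero _

theorem qp_natCast_div_two (q : ℝ) (n : ℕ) : qp q ((n : ℂ) / 2) = qp q (1 / 2) ^ n := by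
  rw [qp, qp, ← Complex.exp_nat_mul]; congr 1; ring

theorem qp_half_pow_ne_one {q : ℝ} (hq : 0 < q) (hq1 : q ≠ 1) {n : ℕ} (hn : n ≠ 0) :
    qp q (1 / 2) ^ n ≠ 1 := by
  have e : qp q (1 / 2) = ((Real.exp (1 / 2 * Real.log q) : ℝ) : ℂ) := by
    rw [qp]; push_cast; rfl
  rw [e]
  norm_cast
  rw [pow_eq_one_iff_of_nonneg (Real.exp_pos _).le hn, Real.exp_eq_one_iff]
  have := Real.log_ne_zero_of_pos_of_ne_one hq hq1
  simpa using this

theorem exists_qp_eq {q : ℝ} (hq : 0 < q) (hq1 : q ≠ 1) {w : ℂ} (hw : w ≠ 0) :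
    ∃ s, qp q s = w := by
  have h : (Real.log q : ℂ) ≠ 0 := by
    exact_mod_cast Real.log_ne_zero_of_pos_of_ne_one hq hq1
  refine ⟨Complex.log w / Real.log q, ?_⟩
  rw [qp, div_mul_cancel₀ _ h, Complex.exp_log hw]

theorem qp_half_sub_inv_ne_zero {q : ℝ} (hq : 0 < q) (hq1 : q ≠ 1) {n : ℕ} (hn : n ≠ 0) :
    qp q (1 / 2) ^ n - (qp q (1 / 2))⁻¹ ^ n ≠ 0 := by
  intro h0
  have ht := pow_ne_zero n (qp_ne_zero q (1 / 2))
  refine qp_half_pow_ne_one hq hq1 (n := n * 2) (by omega) ?_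
  rw [inv_pow, sub_eq_zero] at h0
  rw [pow_mul, sq]
  nth_rewrite 2 [h0]
  exact mul_inv_cancel₀ ht

theorem isLatticeSeq {q : ℝ} (hq : 0 < q) (hq1 : q ≠ 1) :
    IsLatticeSeq (alphaL q) (alphaN q) (gammaN q) := by
  have ht := qp_ne_zero q (1 / 2)
  have h1 := qp_half_sub_inv_ne_zero hq hq1 one_ne_zero
  have hn := fun n : ℕ => qp_half_sub_inv_ne_zero hq hq1 n.succ_ne_zero
  rw [pow_one, pow_one] at h1
  constructor
  · simp [alphaN, qp]
  · simp [gammaN]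
  · intro n
    simp only [alphaN, alphaL, gammaN, qp_neg, qp_natCast_div_two]
    generalize qp q (1 / 2) = t at *
    rw [← inv_pow, ← inv_pow]
    have hti : t * t⁻¹ = 1 := mul_inv_cancel₀ ht
    generalize t⁻¹ = r at *
    rw [show ((t + r) / 2) ^ 2 - 1 = ((t - r) / 2) ^ 2 by linear_combination hti]
    field_simp
    ring
  · intro n
    simp only [alphaN, alphaL, gammaN, qp_neg, qp_natCast_div_two]
    generalize qp q (1 / 2) = t at *
    rw [← inv_pow, ← inv_pow]
    generalize t⁻¹ = r at *
    field_simp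
    ring
  · intro n
    simp only [gammaN, qp_neg, qp_natCast_div_two]
    rw [← inv_pow]
    exact div_ne_zero (hn n) h1

theorem IsLatticeSeq.add {α : ℂ} {al ga : ℕ → ℂ} (hs : IsLatticeSeq α al ga) (i n : ℕ) :
    al (i + n) = al i * al n + (α ^ 2 - 1) * ga i * ga n ∧
      ga (i + n) = ga i * al n + al i * ga n := by
  induction n with
  | zero => simp [hs.al_zero, hs.ga_zero]
  | succ n ih =>
    rw [← add_assoc, hs.al_succ, hs.ga_succ, hs.al_succ, hs.ga_succ, ih.1, ih.2]
    constructor <;> ring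

theorem latX_average (q : ℝ) (c1 c2 c3 s : ℂ) :
    (latX q c1 c2 c3 (s + 1 / 2) + latX q c1 c2 c3 (s - 1 / 2)) / 2 - c3
      = alphaL q * (latX q c1 c2 c3 s - c3) := by
  simp only [latX, alphaL, sub_eq_add_neg s, neg_add, neg_neg, qp_add, qp_neg]
  ring

theorem latX_difference_sq (q : ℝ) (c1 c2 c3 s : ℂ) :
    (latX q c1 c2 c3 (s + 1 / 2) - latX q c1 c2 c3 (s - 1 / 2)) ^ 2 / 4
      = (alphaL q ^ 2 - 1) * ((latX q c1 c2 c3 s - c3) * (latX q c1 c2 c3 s - c3)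
        - 4 * (c1 * c2)) := by
  simp only [latX, alphaL, sub_eq_add_neg s, neg_add, neg_neg, qp_add, qp_neg]
  have h1 := qp_ne_zero q (1 / 2)
  have h2 := qp_ne_zero q s
  field_simp
  ring

theorem exists_latX_eq {q : ℝ} (hq : 0 < q) (hq1 : q ≠ 1) {c1 c2 : ℂ} (hc : c1 * c2 ≠ 0)
    (c3 z : ℂ) : ∃ s, latX q c1 c2 c3 s = z := by
  have hc1 := left_ne_zero_of_mul hc
  have hc2 := right_ne_zero_of_mul hc
  obtain ⟨r, hr⟩ := IsAlgClosed.exists_pow_nat_eq ((z - c3) ^ 2 - 4 * c2 * c1) two_pos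
  have hw : c2 * (((z - c3) + r) / (2 * c2)) ^ 2 - (z - c3) * (((z - c3) + r) / (2 * c2)) + c1
      = 0 := by
    field_simp
    linear_combination hr
  generalize ((z - c3) + r) / (2 * c2) = w at hw
  have hw0 : w ≠ 0 := by
    rintro rfl
    exact hc1 (by simpa using hw)
  obtain ⟨s, rfl⟩ := exists_qp_eq hq hq1 hw0
  refine ⟨s, ?_⟩
  rw [latX, qp_neg]
  field_simp
  linear_combination hw

theorem polynomial_ext_latX {q : ℝ} (hq : 0 < q) (hq1 : q ≠ 1) {c1 c2 : ℂ} (hc : c1 * c2 ≠ 0)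
    (c3 : ℂ) {f g : ℂ[X]}
    (h : ∀ s, latX q c1 c2 c3 (s + 1 / 2) ≠ latX q c1 c2 c3 (s - 1 / 2) →
      f.eval (latX q c1 c2 c3 s) = g.eval (latX q c1 c2 c3 s)) : f = g := by
  have hα : alphaL q ^ 2 - 1 ≠ 0 := by
    have h1 := qp_half_sub_inv_ne_zero hq hq1 one_ne_zero
    have h0 := mul_inv_cancel₀ (qp_ne_zero q (1 / 2))
    rw [pow_one, pow_one] at h1
    have e : alphaL q ^ 2 - 1 = ((qp q (1 / 2) - (qp q (1 / 2))⁻¹) / 2) ^ 2 := by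
      rw [alphaL, qp_neg]
      linear_combination h0
    rw [e]
    exact pow_ne_zero 2 (div_ne_zero h1 two_ne_zero)
  have hM : ((X - C c3) ^ 2 - C (4 * (c1 * c2)) : ℂ[X]) ≠ 0 := by
    refine (Monic.sub_of_left ((monic_X_sub_C c3).pow 2) ?_).ne_zero
    rw [degree_pow, degree_X_sub_C]
    exact degree_C_le.trans_lt (by norm_num)
  rw [← sub_eq_zero]
  refine (mul_eq_zero.1 (Polynomial.funext fun z => ?_)).resolve_right hM
  obtain ⟨s, rfl⟩ := exists_latX_eq hq hq1 hc c3 z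
  by_cases hs : latX q c1 c2 c3 (s + 1 / 2) = latX q c1 c2 c3 (s - 1 / 2)
  · have := latX_difference_sq q c1 c2 c3 s
    rw [hs, sub_self, zero_pow two_ne_zero, zero_div, eq_comm, mul_eq_zero] at this
    have := this.resolve_left hα
    simp only [eval_mul, eval_sub, eval_pow, eval_X, eval_C, eval_zero]
    linear_combination (f.eval (latX q c1 c2 c3 s) - g.eval (latX q c1 c2 c3 s)) * this
  · simp [h s hs]

theorem isLatticePair {q : ℝ} (hq : 0 < q) (hq1 : q ≠ 1) {c1 c2 c3 : ℂ} (hc : c1 * c2 ≠ 0)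
    {Dx Sx : ℂ[X] → ℂ[X]}
    (hDx : ∀ (f : Polynomial ℂ) (s : ℂ),
      latX q c1 c2 c3 (s + 1/2) ≠ latX q c1 c2 c3 (s - 1/2) →
      (Dx f).eval (latX q c1 c2 c3 s) =
        (f.eval (latX q c1 c2 c3 (s + 1/2)) - f.eval (latX q c1 c2 c3 (s - 1/2))) /
          (latX q c1 c2 c3 (s + 1/2) - latX q c1 c2 c3 (s - 1/2)))
    (hSx : ∀ (f : Polynomial ℂ) (s : ℂ),
      (Sx f).eval (latX q c1 c2 c3 s) =
        (f.eval (latX q c1 c2 c3 (s + 1/2)) + f.eval (latX q c1 c2 c3 (s - 1/2))) / 2) :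
    IsLatticePair (alphaL q) (c1 * c2) (X - C c3) Dx Sx := by
  constructor
  · intro f g
    refine polynomial_ext_latX hq hq1 hc c3 fun s hs => ?_
    simp only [hDx _ _ hs, eval_add]
    ring
  · intro f g
    refine polynomial_ext_latX hq hq1 hc c3 fun s hs => ?_
    simp only [hSx, eval_add]
    ring
  · intro a
    refine polynomial_ext_latX hq hq1 hc c3 fun s hs => ?_
    simp [hDx _ _ hs]
  · intro a
    refine polynomial_ext_latX hq hq1 hc c3 fun s hs => ?_
    simp [hSx]
  · refine polynomial_ext_latX hq hq1 hc c3 fun s hs => ?_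
    rw [hDx _ _ hs]
    simp only [eval_sub, eval_X, eval_C, eval_one]
    rw [sub_sub_sub_cancel_right, div_self (sub_ne_zero.2 hs)]
  · refine polynomial_ext_latX hq hq1 hc c3 fun s hs => ?_
    simp only [hSx, eval_sub, eval_X, eval_C, eval_mul]
    rw [← latX_average]
    ring
  · intro f g
    refine polynomial_ext_latX hq hq1 hc c3 fun s hs => ?_
    simp only [hDx _ _ hs, hSx, eval_add, eval_mul]
    have := sub_ne_zero.2 hs
    field_simp
    ring
  · intro f g
    refine polynomial_ext_latX hq hq1 hc c3 fun s hs => ?_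
    simp only [hDx _ _ hs, hSx, eval_add, eval_mul, eval_sub, eval_X, eval_C]
    rw [← latX_difference_sq]
    have := sub_ne_zero.2 hs
    generalize latX q c1 c2 c3 (s + 1 / 2) = x₁ at *
    generalize latX q c1 c2 c3 (s - 1 / 2) = x₂ at *
    field_simp
    ring

theorem stmt_11 (q : ℝ) (hq : 0 < q) (hq1 : q ≠ 1) (c1 c2 c3 : ℂ) (hc : c1 * c2 ≠ 0)
    (Dx Sx : Polynomial ℂ → Polynomial ℂ)
    (hDx : ∀ (f : Polynomial ℂ) (s : ℂ),
      latX q c1 c2 c3 (s + 1/2) ≠ latX q c1 c2 c3 (s - 1/2) →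
      (Dx f).eval (latX q c1 c2 c3 s) =
        (f.eval (latX q c1 c2 c3 (s + 1/2)) - f.eval (latX q c1 c2 c3 (s - 1/2))) /
          (latX q c1 c2 c3 (s + 1/2) - latX q c1 c2 c3 (s - 1/2)))
    (hSx : ∀ (f : Polynomial ℂ) (s : ℂ),
      (Sx f).eval (latX q c1 c2 c3 s) =
        (f.eval (latX q c1 c2 c3 (s + 1/2)) + f.eval (latX q c1 c2 c3 (s - 1/2))) / 2)
    (pa pb pc pd pe : ℂ)
    (hne : ¬(pa = 0 ∧ pb = 0 ∧ pc = 0 ∧ pd = 0 ∧ pe = 0))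
    (u : Polynomial ℂ →ₗ[ℂ] ℂ) (hu : u ≠ 0)
    (hPearson : ∀ f : Polynomial ℂ,
      u ((C pa * X ^ 2 + C pb * X + C pc) * Dx f) + u ((C pd * X + C pe) * Sx f) = 0) :
    IsRegularFunc u ↔
      ∀ n : ℕ, dN q pa pd n ≠ 0 ∧
        phiK q pa pb pc pd pe c1 c2 c3 n
          (c3 - eN q pa pb pd pe c3 n / dN q pa pd (2 * n)) ≠ 0 := by
  have h := isLatticePair hq hq1 hc hDx hSx
  have hs := isLatticeSeq hq hq1
  set B := 2 * pa * c3 + pb with hB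
  set E := pd * c3 + pe with hE
  set K := pa * c3 ^ 2 + pb * c3 + pc with hK
  have hφ : C pa * X ^ 2 + C pb * X + C pc
      = C pa * ((X - C c3) * (X - C c3)) + C B * (X - C c3) + C K := by
    simp only [hB, hK, map_add, map_mul, map_pow, map_ofNat]; ring
  have hψ : C pd * X + C pe = C pd * (X - C c3) + C E := by
    simp only [hE, map_add, map_mul]; ring
  have hv : ∀ f, u ((C pa * X ^ 2 + C pb * X + C pc) * Dx f + (C pd * X + C pe) * Sx f) = 0 :=
    fun f => by rw [map_add, hPearson]
  have hlead : IsRegularFunc u → ∀ n, dN q pa pd n ≠ 0 := by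
    intro hreg n
    refine h.lead_ne_zero hs hreg hφ hψ hv (fun h0 => hne ?_) n
    have k0 := congrArg (fun p => p.coeff 0) h0.1
    have k1 := congrArg (fun p => p.coeff 1) h0.1
    have k2 := congrArg (fun p => p.coeff 2) h0.1
    have l0 := congrArg (fun p => p.coeff 0) h0.2
    have l1 := congrArg (fun p => p.coeff 1) h0.2
    simp [coeff_X, coeff_C, coeff_X_pow] at k0 k1 k2 l0 l1
    exact ⟨k2, k1, k0, l1, l0⟩
  suffices hmain : (∀ n, dN q pa pd n ≠ 0) → (IsRegularFunc u ↔ ∀ n,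
      phiK q pa pb pc pd pe c1 c2 c3 n
        (c3 - eN q pa pb pd pe c3 n / dN q pa pd (2 * n)) ≠ 0) by
    rw [forall_and]
    exact ⟨fun hr => ⟨hlead hr, (hmain (hlead hr)).1 hr⟩, fun hn => (hmain hn.1).2 hn.2⟩
  intro hd
  have hd' : ∀ n, pa * gammaN q n + pd * alphaN q n ≠ 0 := hd
  have hal1 : alphaN q 1 = alphaL q := by
    rw [show (1 : ℕ) = 0 + 1 from rfl, hs.al_succ, hs.al_zero, hs.ga_zero]; ring
  have hga1 : gammaN q 1 = 1 := by
    rw [show (1 : ℕ) = 0 + 1 from rfl, hs.ga_succ, hs.al_zero, hs.ga_zero]; ring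
  have hu1 : u 1 ≠ 0 := by
    intro h1
    refine hu (LinearMap.ext fun f => ?_)
    obtain ⟨g, r, -, rfl⟩ := h.exists_hypergeometric_eq hs (b := B) (e := K) (l := E) hd' _ f le_rfl
    rw [← hφ, ← hψ, map_add, hv, ← mul_one (C r), IsLatticePair.map_C_mul, h1]
    simp
  have hal2 : ∀ k, alphaN q (2 * (k + 1)) = (2 * alphaL q ^ 2 - 1) * alphaN q (2 * k)
      + (alphaL q ^ 2 - 1) * (2 * alphaL q) * gammaN q (2 * k) := by
    intro k
    rw [show 2 * (k + 1) = 2 * k + 1 + 1 by ring, hs.al_succ, hs.al_succ, hs.ga_succ]; ring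
  have hga2 : ∀ k, gammaN q (2 * (k + 1)) = (2 * alphaL q ^ 2 - 1) * gammaN q (2 * k)
      + 2 * alphaL q * alphaN q (2 * k) := by
    intro k
    rw [show 2 * (k + 1) = 2 * k + 1 + 1 by ring, hs.ga_succ, hs.al_succ, hs.ga_succ]; ring
  have hex := fun n => h.exists_monic_orthogonal hs
    (fun k => pd * (alphaL q ^ 2 - 1) * gammaN q (2 * k) + pa * alphaN q (2 * k))
    (fun k => B * alphaN q k + E * (alphaL q ^ 2 - 1) * gammaN q k)
    (fun k => K + 2 * pa * (c1 * c2)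
      - 2 * (c1 * c2) * (pd * (alphaL q ^ 2 - 1) * gammaN q (2 * k) + pa * alphaN q (2 * k)))
    (fun k => dN q pa pd (2 * k)) (fun k => eN q pa pb pd pe c3 k)
    (fun k n => by
      convert hd (2 * k + n) using 1
      simp only [dN, hs.add]
      ring)
    (fun k => by simp only [dN, hal2, hga2]; ring)
    (fun k => by simp only [eN, ← hB, ← hE, hs.al_succ, hs.ga_succ]; ring)
    (fun k => by ring)
    (fun k => by simp only [dN, hal2, hga2]; ring)
    (fun k => by simp only [eN, ← hB, ← hE, hs.al_succ, hs.ga_succ]; ring)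
    n 0 u (by
      intro f
      convert hv f using 3
      · rw [hφ]
        simp [hs.al_zero, hs.ga_zero, mul_comm, mul_left_comm]
      · rw [hψ]
        simp [dN, eN, hs.al_zero, hs.ga_zero, ← hE])
  choose P hPm hPn hPo hPi using hex
  have hval : ∀ n, (pd * (alphaL q ^ 2 - 1) * gammaN q (2 * n) + pa * alphaN q (2 * n))
      * (eN q pa pb pd pe c3 n / dN q pa pd (2 * n)) ^ 2
      - (B * alphaN q n + E * (alphaL q ^ 2 - 1) * gammaN q n)
        * (eN q pa pb pd pe c3 n / dN q pa pd (2 * n))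
      + (K + 2 * pa * (c1 * c2)
      - 2 * (c1 * c2) * (pd * (alphaL q ^ 2 - 1) * gammaN q (2 * n) + pa * alphaN q (2 * n)))
      = phiK q pa pb pc pd pe c1 c2 c3 n
        (c3 - eN q pa pb pd pe c3 n / dN q pa pd (2 * n)) := by
    intro n
    rw [phiK]
    ring
  simp only [zero_add, hval] at hPi
  constructor
  · intro hreg n
    obtain ⟨Q, hQm, hQn, hQo, hQQ⟩ := hreg.exists_orthogonal
    have hPQ : (P (n + 1) - Q (n + 1)).degree < ((n + 1 : ℕ) : WithBot ℕ) := by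
      refine degree_lt_of_coeff_eq_zero (natDegree_le_iff_degree_lt_succ.1
        (natDegree_sub_le_of_le_of_le (hPn _).le (hQn _).le)) ?_
      have e1 := (hPm (n + 1)).coeff_natDegree
      have e2 := (hQm (n + 1)).coeff_natDegree
      rw [hPn] at e1
      rw [hQn] at e2
      rw [coeff_sub, e1, e2, sub_self]
    have e1 := hPo _ _ hPQ
    have e2 := hQo _ _ hPQ
    rw [mul_sub, map_sub, mul_comm (Q _)] at e2
    rw [mul_sub, map_sub] at e1
    refine ((hPi (n + 1)).1 ?_).2 n n.lt_succ_self
    rw [show u (P (n + 1) * P (n + 1)) = u (Q (n + 1) * Q (n + 1)) by linear_combination e1 + e2]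
    exact hQQ _
  · intro hn
    refine ⟨P, hPm, hPn, ?_, fun n => (hPi n).2 ⟨hu1, fun j _ => hn j⟩⟩
    intro i j hij
    rcases lt_or_gt_of_ne hij with hlt | hlt
    · rw [mul_comm]
      refine hPo _ _ ?_
      rw [degree_eq_natDegree (hPm i).ne_zero, hPn]
      exact_mod_cast hlt
    · refine hPo _ _ ?_
      rw [degree_eq_natDegree (hPm j).ne_zero, hPn]
      exact_mod_cast hlt
end
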